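/- Suppose each of the sets A_1,…,A_s either is a singleton or is infinite, and let (N_k)_{k≥1} be an increasing sequence of positive integers with S_{N_k}^{(A_r)} ≠ ∅ for all k and all r∈[s]. Then for every pair of words w_1, w_2 ∈ 𝔽 with w_1 ≉ e and w_2 ≉ e, there exists δ > 0 such that E_k[ tr U_{w_1}(σ) · tr U_{w_2}(σ) ] = O(1/N_k^{1+δ}) as k → ∞. -/

import Mathlib

noncomputable section

open Filter Topology

/-- `permSet A N` is `S_N^(A)`: the set of permutations of `{1,…,N}` (modeled as
`Fin N`) all of whose cycles have length belonging to `A`; the length of the cycle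
of `σ` containing `i` is the minimal period of `i` under `σ`. -/
def permSet (A : Set ℕ) (N : ℕ) : Set (Equiv.Perm (Fin N)) :=
  {σ | ∀ i : Fin N, Function.minimalPeriod (⇑σ) i ∈ A}

/-- `pN A k N` is `p_N^(A)(k)`: the probability that, in a uniformly random
permutation from `S_N^(A)`, the first element belongs to a cycle of length `k`. -/
def pN (A : Set ℕ) (k N : ℕ) : ℝ :=
  (Nat.card {σ : Equiv.Perm (Fin N) // σ ∈ permSet A N ∧
      ∃ i : Fin N, (i : ℕ) = 0 ∧ Function.minimalPeriod (⇑σ) i = k} : ℝ) /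
    (Nat.card ↥(permSet A N) : ℝ)

/-- The permutation matrix of `σ`: `(M_σ)_{i,j} = 1` iff `σ(j) = i`. -/
def permMat (N : ℕ) (σ : Equiv.Perm (Fin N)) : Matrix (Fin N) (Fin N) ℂ :=
  Matrix.of fun i j => if σ j = i then 1 else 0

/-- The normalized trace of an `N × N` matrix. -/
def ntr {N : ℕ} (M : Matrix (Fin N) (Fin N) ℂ) : ℂ := Matrix.trace M / (N : ℂ)

/-- `Uword N σ w` is the matrix obtained from the word `w` by replacing each letter
`g_r` (encoded `(r, true)`) by `M_{σ_r}` and each `g_r^*` (encoded `(r, false)`) by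
`M_{σ_r}^* = M_{σ_r⁻¹}`, and multiplying; the empty word gives the identity. -/
def Uword {s : ℕ} (N : ℕ) (σ : Fin s → Equiv.Perm (Fin N))
    (w : List (Fin s × Bool)) : Matrix (Fin N) (Fin N) ℂ :=
  (w.map fun p => if p.2 then permMat N (σ p.1) else permMat N ((σ p.1)⁻¹)).prod

/-- `EE A N h` is the average of `h(σ₁,…,σ_s)` over all tuples
`(σ₁,…,σ_s) ∈ S_N^{(A_1)} × ⋯ × S_N^{(A_s)}`. -/
def EE {s : ℕ} (A : Fin s → Set ℕ) (N : ℕ)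
    (h : (Fin s → Equiv.Perm (Fin N)) → ℂ) : ℂ :=
  (∑ᶠ σ : {σ : Fin s → Equiv.Perm (Fin N) // ∀ r, σ r ∈ permSet (A r) N}, h σ.1) /
    ∏ r : Fin s, (Nat.card ↥(permSet (A r) N) : ℂ)

/-- The defining relations of the congruence `≈`. -/
inductive WordRel (s : ℕ) (d : Fin s → ℕ∞) :
    List (Fin s × Bool) → List (Fin s × Bool) → Prop
  | cancel₁ (r : Fin s) : WordRel s d [(r, true), (r, false)] []
  | cancel₂ (r : Fin s) : WordRel s d [(r, false), (r, true)] []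
  | power₁ (r : Fin s) (m : ℕ) (h : d r = (m : ℕ∞)) :
      WordRel s d (List.replicate m (r, true)) []
  | power₂ (r : Fin s) (m : ℕ) (h : d r = (m : ℕ∞)) :
      WordRel s d (List.replicate m (r, false)) []

/-- The monoid congruence `≈` on the free monoid on the letters `g_r` (encoded
`(r, true)`) and `g_r^*` (encoded `(r, false)`), generated by the relations
`g_r g_r^* ≈ g_r^* g_r ≈ e` and (for `d_r < ∞`) `g_r^{d_r} ≈ (g_r^*)^{d_r} ≈ e`. -/
inductive WordEquiv (s : ℕ) (d : Fin s → ℕ∞) :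
    List (Fin s × Bool) → List (Fin s × Bool) → Prop
  | of {w₁ w₂} : WordRel s d w₁ w₂ → WordEquiv s d w₁ w₂
  | refl (w) : WordEquiv s d w w
  | symm {w₁ w₂} : WordEquiv s d w₁ w₂ → WordEquiv s d w₂ w₁
  | trans {w₁ w₂ w₃} : WordEquiv s d w₁ w₂ → WordEquiv s d w₂ w₃ → WordEquiv s d w₁ w₃
  | mul {w₁ w₂ v₁ v₂} : WordEquiv s d w₁ w₂ → WordEquiv s d v₁ v₂ →
      WordEquiv s d (w₁ ++ v₁) (w₂ ++ v₂)


/-- Formal Euler derivative. -/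
theorem psD_coeff (p : PowerSeries ℝ) (n : ℕ) :
    PowerSeries.coeff n (PowerSeries.X * PowerSeries.derivative ℝ p) =
      (n : ℝ) * PowerSeries.coeff n p := by
  cases n with
  | zero => simp
  | succ n =>
    rw [PowerSeries.coeff_succ_X_mul]
    simp [PowerSeries.coeff_derivative]
    ring

/-- the recursively defined solution of `n H_n = ∑_{j<n} b (n-j) H_j`. -/
def Hrec (b : ℕ → ℝ) : ℕ → ℝ
  | 0 => 1
  | (n+1) => (∑ j : Fin (n+1), b (n + 1 - j) * Hrec b j) / (n+1)

theorem Hrec_succ (b : ℕ → ℝ) (n : ℕ) :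
    ((n:ℝ)+1) * Hrec b (n+1) = ∑ j ∈ Finset.range (n+1), b (n+1-j) * Hrec b j := by
  rw [Hrec, ← Fin.sum_univ_eq_sum_range (fun j => b (n+1-j) * Hrec b j)]
  field_simp

theorem Hrec_nonneg (b : ℕ → ℝ) (hb : ∀ j, 0 ≤ b j) (n : ℕ) : 0 ≤ Hrec b n := by
  induction n using Nat.strong_induction_on with
  | _ n ih =>
    cases n with
    | zero => simp [Hrec]
    | succ n =>
      rw [Hrec]
      apply div_nonneg _ (by positivity)
      exact Finset.sum_nonneg fun j _ => mul_nonneg (hb _) (ih _ j.2)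

/-- small tail: `∑ b j min(1/j,1/K)` is small. -/
theorem exists_small (b : ℕ → ℝ) (hb : ∀ j, 0 ≤ b j)
    (hs : Summable fun j : ℕ => b j / j) :
    ∃ K : ℕ, 0 < K ∧ ∀ F : Finset ℕ, (∀ j ∈ F, 0 < j) →
      ∑ j ∈ F, b j / (max j K : ℕ) ≤ 1/2 := by
  obtain ⟨J, hJ⟩ : ∃ J : ℕ, ∑' j, b (j + J) / ((j + J : ℕ):ℝ) ≤ 1/4 := by
    have := tendsto_sum_nat_add (fun j : ℕ => b j / j)
    have := this.eventually (gt_mem_nhds (show (0:ℝ) < 1/4 by norm_num))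
    obtain ⟨J, hJ⟩ := this.exists
    exact ⟨J, le_of_lt hJ⟩
  set S := ∑ j ∈ Finset.range J, b j with hS
  have hS0 : 0 ≤ S := Finset.sum_nonneg fun j _ => hb j
  obtain ⟨K, hK⟩ := exists_nat_gt (4 * S + 1)
  have hK0 : (0:ℝ) < K := by linarith
  refine ⟨K, by exact_mod_cast hK0, fun F hF => ?_⟩
  have e1 : ∑ j ∈ F, b j / (max j K : ℕ) = ∑ j ∈ F with j < J, b j / (max j K : ℕ) + ∑ j ∈ F with ¬ j < J, b j / (max j K : ℕ) :=
    (Finset.sum_filter_add_sum_filter_not _ _ _).symm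
  have e2 : ∑ j ∈ F with j < J, b j / (max j K : ℕ) ≤ 1/4 := by
    calc _ ≤ ∑ j ∈ F with j < J, b j / K := by
          apply Finset.sum_le_sum
          intro j _
          apply div_le_div_of_nonneg_left (hb j) hK0
          exact_mod_cast le_max_right _ _
      _ ≤ ∑ j ∈ Finset.range J, b j / K := by
          apply Finset.sum_le_sum_of_subset_of_nonneg
          · intro j; simp
          · intro j _ _; exact div_nonneg (hb j) hK0.le
      _ = S / K := by rw [← Finset.sum_div]
      _ ≤ 1/4 := by
          rw [div_le_iff₀ hK0]; linarith
  have e3 : ∑ j ∈ F with ¬ j < J, b j / (max j K : ℕ) ≤ 1/4 := by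
    calc _ ≤ ∑ j ∈ F with ¬ j < J, b j / j := by
          apply Finset.sum_le_sum
          intro j hj
          have hj0 : 0 < j := hF j (Finset.mem_filter.1 hj).1
          apply div_le_div_of_nonneg_left (hb j) (by exact_mod_cast hj0)
          exact_mod_cast le_max_left _ _
      _ = ∑ i ∈ (F.filter (fun j => ¬ j < J)).image (fun j => j - J), b (i + J) / ((i + J : ℕ):ℝ) := by
          rw [Finset.sum_image]
          · apply Finset.sum_congr rfl
            intro j hj
            have : j - J + J = j := by
              have := (Finset.mem_filter.1 hj).2
              omega
            rw [this]
          · intro a ha c hc h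
            have h1 := (Finset.mem_filter.1 ha).2
            have h2 := (Finset.mem_filter.1 hc).2
            simp only at h
            omega
      _ ≤ ∑' j, b (j + J) / ((j + J : ℕ):ℝ) := by
          apply Summable.sum_le_tsum
          · intro i _
            exact div_nonneg (hb _) (by positivity)
          · exact (summable_nat_add_iff (f := fun j : ℕ => b j / (j:ℝ)) J).2 hs
      _ ≤ 1/4 := hJ
  rw [e1]; linarith

theorem Hrec_summable (b : ℕ → ℝ) (hb : ∀ j, 0 ≤ b j)
    (hs : Summable fun j : ℕ => b j / j) : Summable (Hrec b) := by
  obtain ⟨K, hK, hF⟩ := exists_small b hb hs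
  have H0 := Hrec_nonneg b hb
  apply summable_of_sum_range_le (c := 2 * ∑ n ∈ Finset.range K, Hrec b n) H0
  intro N
  set S := ∑ n ∈ Finset.range N, Hrec b n
  suffices S ≤ ∑ n ∈ Finset.range K, Hrec b n + S / 2 by linarith
  have hle : ∀ n, Hrec b n ≤ (if n < K then Hrec b n else 0) +
      ∑ j ∈ Finset.range n, b (n - j) / (max (n-j) K : ℕ) * Hrec b j := by
    intro n
    have hnn : 0 ≤ ∑ j ∈ Finset.range n, b (n - j) / (max (n-j) K : ℕ) * Hrec b j :=
      Finset.sum_nonneg fun j _ => mul_nonneg (div_nonneg (hb _) (by positivity)) (H0 _)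
    split_ifs with h
    · linarith
    · obtain ⟨m, rfl⟩ : ∃ m, n = m + 1 := ⟨n - 1, by omega⟩
      have := Hrec_succ b m
      have e : Hrec b (m+1) = ∑ j ∈ Finset.range (m+1), b (m+1-j) / ((m:ℝ)+1) * Hrec b j := by
        have h1 : ((m:ℝ)+1) ≠ 0 := by positivity
        rw [eq_div_of_mul_eq h1 ((mul_comm _ _).trans this), Finset.sum_div]
        apply Finset.sum_congr rfl
        intro j _
        ring
      rw [zero_add, e]
      apply Finset.sum_le_sum
      intro j hj
      apply mul_le_mul_of_nonneg_right _ (H0 _)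
      apply div_le_div_of_nonneg_left (hb _)
      · have : 0 < max (m+1-j) K := lt_of_lt_of_le hK (le_max_right _ _)
        exact_mod_cast this
      · have : max (m+1-j) K ≤ m + 1 := by
          apply max_le <;> omega
        exact_mod_cast this
  calc S ≤ ∑ n ∈ Finset.range N, ((if n < K then Hrec b n else 0) +
      ∑ j ∈ Finset.range n, b (n - j) / (max (n-j) K : ℕ) * Hrec b j) :=
        Finset.sum_le_sum fun n _ => hle n
    _ = ∑ n ∈ Finset.range N, (if n < K then Hrec b n else 0) + ∑ n ∈ Finset.range N, 
      ∑ j ∈ Finset.range n, b (n - j) / (max (n-j) K : ℕ) * Hrec b j := Finset.sum_add_distrib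
    _ ≤ _ := by
      apply add_le_add
      · rw [← Finset.sum_filter]
        apply Finset.sum_le_sum_of_subset_of_nonneg
        · intro j; simp
        · intro j _ _; exact H0 j
      · rw [Finset.sum_comm' (t' := Finset.range N) (s' := fun j => Finset.Ioo j N)]
        · rw [show S / 2 = ∑ j ∈ Finset.range N, (1/2) * Hrec b j by rw [← Finset.mul_sum]; ring]
          apply Finset.sum_le_sum
          intro j _
          rw [← Finset.sum_mul]
          apply mul_le_mul_of_nonneg_right _ (H0 _)
          have := hF ((Finset.Ioo j N).image (fun n => n - j)) (by
            intro i hi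
            simp only [Finset.mem_image, Finset.mem_Ioo] at hi
            omega)
          rw [Finset.sum_image] at this
          · exact this
          · intro a ha c hc h
            simp at ha hc h
            omega
        · intro x y
          simp
          omega

theorem Hrec_ps (b : ℕ → ℝ) (hb0 : b 0 = 0) :
    PowerSeries.X * PowerSeries.derivative ℝ (PowerSeries.mk (Hrec b)) =
      PowerSeries.mk b * PowerSeries.mk (Hrec b) := by
  ext n
  rw [psD_coeff, PowerSeries.coeff_mul]
  simp only [PowerSeries.coeff_mk]
  cases n with
  | zero => simp [hb0]
  | succ n =>
    push_cast
    rw [Hrec_succ, Finset.Nat.sum_antidiagonal_eq_sum_range_succ_mk]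
    rw [Finset.sum_range_succ' (fun k => b k * Hrec b (n + 1 - k))]
    simp only [hb0, zero_mul, add_zero]
    rw [← Finset.sum_range_reflect]
    apply Finset.sum_congr rfl
    intro j hj
    have := Finset.mem_range.1 hj
    congr 2 <;> omega

theorem ps_dom (h H P Q : PowerSeries ℝ)
    (h1 : PowerSeries.X * PowerSeries.derivative ℝ h = P * h)
    (h2 : PowerSeries.X * PowerSeries.derivative ℝ H = Q * H)
    (hPQ : ∀ n, |PowerSeries.coeff n P| ≤ PowerSeries.coeff n Q)
    (hQ0 : PowerSeries.coeff 0 Q = 0)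
    (h0 : |PowerSeries.coeff 0 h| ≤ PowerSeries.coeff 0 H) (n : ℕ) :
    |PowerSeries.coeff n h| ≤ PowerSeries.coeff n H := by
  induction n using Nat.strong_induction_on with
  | _ n ih =>
    rcases Nat.eq_zero_or_pos n with rfl | hn
    · exact h0
    · have e1 := psD_coeff h n
      have e2 := psD_coeff H n
      rw [h1, PowerSeries.coeff_mul] at e1
      rw [h2, PowerSeries.coeff_mul] at e2
      have hn' : (0:ℝ) < n := by exact_mod_cast hn
      have hP0 : PowerSeries.coeff 0 P = 0 := by
        have := hPQ 0; rw [hQ0] at this; exact abs_nonpos_iff.1 this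
      refine le_of_mul_le_mul_left ?_ hn'
      have e3 : (n:ℝ) * |PowerSeries.coeff n h| = |(n:ℝ) * PowerSeries.coeff n h| := by
        rw [abs_mul, abs_of_pos hn']
      rw [← e2, e3, ← e1]
      refine (Finset.abs_sum_le_sum_abs _ _).trans (Finset.sum_le_sum ?_)
      rintro ⟨i, j⟩ hij
      have hij' : i + j = n := by simpa using hij
      simp only [abs_mul]
      rcases Nat.eq_zero_or_pos i with rfl | hi
      · rw [hP0, hQ0]; simp
      · exact mul_le_mul (hPQ i) (ih j (by omega)) (abs_nonneg _) ((abs_nonneg _).trans (hPQ i))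

/-- the series `∑_{k ≥ 1} X^k`. -/
def psG : PowerSeries ℝ := PowerSeries.mk fun n => if n = 0 then 0 else 1

theorem psG_mul : (1 - PowerSeries.X) * psG = PowerSeries.X := by
  ext n
  rw [sub_mul, one_mul, map_sub]
  cases n with
  | zero => simp [psG]
  | succ n =>
    rw [PowerSeries.coeff_succ_X_mul]
    cases n with
    | zero => simp [psG]
    | succ n => simp [psG, PowerSeries.coeff_X]

theorem ps_h (a F : PowerSeries ℝ)
    (h1 : PowerSeries.X * PowerSeries.derivative ℝ a = F * a) :
    PowerSeries.X * PowerSeries.derivative ℝ ((1 - PowerSeries.X) * a) =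
      (F - psG) * ((1 - PowerSeries.X) * a) := by
  have h2 : PowerSeries.derivative ℝ ((1 - PowerSeries.X) * a) =
      (1 - PowerSeries.X) * PowerSeries.derivative ℝ a - a := by
    rw [Derivation.leibniz]
    simp [PowerSeries.derivative_X]
    ring
  rw [h2]
  have := psG_mul
  linear_combination (1 - PowerSeries.X) * h1 + a * this

/-- Main analytic consequence: boundedness and convergence. -/
theorem rec_conv (f a : ℕ → ℝ) (hf0 : f 0 = 0)
    (hs : Summable fun j : ℕ => |f j - 1| / j)
    (h1 : PowerSeries.X * PowerSeries.derivative ℝ (PowerSeries.mk a) =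
      PowerSeries.mk f * PowerSeries.mk a) (ha : a 0 = 1) :
    (∃ l, Tendsto a atTop (𝓝 l)) := by
  set b : ℕ → ℝ := fun j => if j = 0 then 0 else |f j - 1| with hb
  have hb0 : ∀ j, 0 ≤ b j := by intro j; simp only [hb]; split_ifs <;> positivity
  have hbs : Summable fun j : ℕ => b j / j := by
    refine hs.congr ?_
    intro j
    rcases eq_or_ne j 0 with rfl | h
    · simp
    · simp [hb, h]
  have hH := Hrec_summable b hb0 hbs
  have key := ps_dom _ _ _ _ (ps_h _ _ h1) (Hrec_ps b (by simp [hb])) (by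
    intro n
    simp only [psG, map_sub, PowerSeries.coeff_mk, hb]
    split_ifs with h
    · subst h; simp [hf0]
    · rfl) (by simp [hb]) (by
    simp [ha, Hrec])
  have hsum : Summable fun n => PowerSeries.coeff n ((1 - PowerSeries.X) * PowerSeries.mk a) := by
    apply Summable.of_abs
    exact Summable.of_nonneg_of_le (fun _ => abs_nonneg _) key (by simpa using hH)
  have e : ∀ n, ∑ i ∈ Finset.range (n+1), PowerSeries.coeff i ((1 - PowerSeries.X) * PowerSeries.mk a) = a n := by
    intro n
    induction n with
    | zero => simp
    | succ n ih =>
      rw [Finset.sum_range_succ, ih, sub_mul, one_mul, map_sub, PowerSeries.coeff_succ_X_mul]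
      simp
  refine ⟨∑' n, PowerSeries.coeff n ((1 - PowerSeries.X) * PowerSeries.mk a), ?_⟩
  · have := (tendsto_add_atTop_iff_nat 1).2 hsum.hasSum.tendsto_sum_nat
    exact this.congr e

theorem rec_lower (f a : ℕ → ℝ) (hf0 : f 0 = 0) (hf1 : ∀ j, f j ≤ 1)
    (hs : Summable fun j : ℕ => |f j - 1| / j)
    (h1 : PowerSeries.X * PowerSeries.derivative ℝ (PowerSeries.mk a) =
      PowerSeries.mk f * PowerSeries.mk a) (ha : a 0 = 1) :
    ∃ l, l ≠ 0 ∧ Tendsto a atTop (𝓝 l) := by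
  obtain ⟨l, hl⟩ := rec_conv f a hf0 hs h1 ha
  refine ⟨l, ?_, hl⟩
  rintro rfl
  set b : ℕ → ℝ := fun j => if j = 0 then 0 else 1 - f j with hb
  have hb0 : ∀ j, 0 ≤ b j := by
    intro j; simp only [hb]; split_ifs
    · rfl
    · linarith [hf1 j]
  have hbs : Summable fun j : ℕ => b j / j := by
    refine hs.congr ?_
    intro j
    rcases eq_or_ne j 0 with rfl | h
    · simp
    · simp only [hb, h, if_false]
      rw [abs_sub_comm, abs_of_nonneg (by linarith [hf1 j])]
  have hH := Hrec_summable b hb0 hbs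
  have hH0 := Hrec_nonneg b hb0
  have h2 := Hrec_ps b (by simp [hb])
  have hfb : PowerSeries.mk f + PowerSeries.mk b = psG := by
    ext n
    simp only [psG, map_add, PowerSeries.coeff_mk, hb]
    split_ifs with h
    · subst h; simp [hf0]
    · ring
  set v := PowerSeries.mk a * PowerSeries.mk (Hrec b) with hv
  have hD : PowerSeries.X * PowerSeries.derivative ℝ v = psG * v := by
    rw [hv, Derivation.leibniz, ← hfb]
    simp only [smul_eq_mul]
    linear_combination PowerSeries.mk (Hrec b) * h1 + PowerSeries.mk a * h2
  have hv1 : ∀ n, PowerSeries.coeff n v = 1 := by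
    have h3 := ps_h _ _ hD
    rw [sub_self, zero_mul] at h3
    have h4 : ∀ n, PowerSeries.coeff (n+1) ((1 - PowerSeries.X) * v) = 0 := by
      intro n
      have := psD_coeff ((1 - PowerSeries.X) * v) (n+1)
      rw [h3] at this
      simp only [map_zero] at this
      have h5 : (((n+1:ℕ)):ℝ) ≠ 0 := by positivity
      exact (mul_eq_zero.1 this.symm).resolve_left h5
    intro n
    induction n with
    | zero => simp [hv, ha, Hrec]
    | succ n ih =>
      have := h4 n
      rw [sub_mul, one_mul, map_sub, PowerSeries.coeff_succ_X_mul, ih] at this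
      linarith
  -- a → 0, H summable : convolution → 0
  have hab : ∃ C, ∀ n, |a n| ≤ C := by
    obtain ⟨C, hC⟩ := (Metric.isBounded_range_of_tendsto a hl).exists_norm_le
    exact ⟨C, fun n => hC _ ⟨n, rfl⟩⟩
  obtain ⟨C, hC⟩ := hab
  have hconv : Tendsto (fun n => ∑' j, if j ≤ n then a (n - j) * Hrec b j else 0) atTop (𝓝 (∑' j : ℕ, (0:ℝ))) := by
    apply tendsto_tsum_of_dominated_convergence (bound := fun j => C * Hrec b j)
    · exact hH.mul_left C
    · intro j
      have : Tendsto (fun n => a (n - j) * Hrec b j) atTop (𝓝 0) := by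
        have h := (hl.comp (tendsto_sub_atTop_nat j)).mul_const (Hrec b j)
        simpa using h
      apply this.congr'
      filter_upwards [eventually_ge_atTop j] with n hn
      simp [hn]
    · filter_upwards with n j
      split_ifs
      · rw [norm_mul, Real.norm_of_nonneg (hH0 j)]
        exact mul_le_mul_of_nonneg_right (hC _) (hH0 j)
      · rw [norm_zero]; exact mul_nonneg ((abs_nonneg _).trans (hC 0)) (hH0 j)
  have heq : ∀ n, (∑' j, if j ≤ n then a (n - j) * Hrec b j else 0) = 1 := by
    intro n
    rw [tsum_eq_sum (s := Finset.range (n+1))]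
    · rw [← hv1 n, hv, PowerSeries.coeff_mul, Finset.Nat.sum_antidiagonal_eq_sum_range_succ_mk, ← Finset.sum_range_reflect]
      apply Finset.sum_congr rfl
      intro j hj
      have := Finset.mem_range.1 hj
      rw [if_pos (by omega)]
      simp only [PowerSeries.coeff_mk]
      congr 2 <;> omega
    · intro j hj
      rw [if_neg]
      simpa using hj
  simp only [heq, tsum_zero] at hconv
  exact one_ne_zero (tendsto_nhds_unique tendsto_const_nhds hconv)


/-- Weighted sum over permutations. -/
def Wt (α : Type) [Fintype α] [DecidableEq α] (g : ℕ → ℝ) : ℝ :=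
  ∑ σ : Equiv.Perm α, ∏ i, g (Function.minimalPeriod σ i)

/-- Weighted sum over permutations with `x` in a cycle of length `k`, this cycle not weighted. -/
def Tt (α : Type) [Fintype α] [DecidableEq α] (x : α) (k : ℕ) (g : ℕ → ℝ) : ℝ :=
  ∑ σ : Equiv.Perm α, if Function.minimalPeriod σ x = k then
    ∏ i, (if Equiv.Perm.SameCycle σ x i then 1 else g (Function.minimalPeriod σ i)) else 0

theorem minimalPeriod_permCongr {α β : Type} (e : α ≃ β) (σ : Equiv.Perm α) (x : α) :
    Function.minimalPeriod (e.permCongr σ) (e x) = Function.minimalPeriod σ x := by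
  apply Function.minimalPeriod_eq_minimalPeriod_iff.2
  intro n
  have : ∀ n, ((e.permCongr σ)^[n]) (e x) = e (σ^[n] x) := by
    intro n
    induction n with
    | zero => rfl
    | succ n ih => rw [Function.iterate_succ_apply', ih, Function.iterate_succ_apply']; simp
  simp [Function.IsPeriodicPt, Function.IsFixedPt, this]

theorem sameCycle_permCongr {α β : Type} (e : α ≃ β) (σ : Equiv.Perm α) (x y : α) :
    Equiv.Perm.SameCycle (e.permCongr σ) (e x) (e y) ↔ Equiv.Perm.SameCycle σ x y := by
  have : ∀ n : ℤ, ((e.permCongr σ)^n) (e x) = e ((σ^n) x) := by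
    intro n
    have : (e.permCongr σ)^n = e.permCongr (σ^n) := by
      exact (map_zpow (e.permCongrHom) σ n).symm
    rw [this]; simp
  simp [Equiv.Perm.SameCycle, this]

theorem Wt_congr {α β : Type} [Fintype α] [Fintype β] [DecidableEq α] [DecidableEq β] (e : α ≃ β) (g : ℕ → ℝ) :
    Wt α g = Wt β g := by
  unfold Wt
  refine Fintype.sum_equiv e.permCongr _ _ ?_
  intro σ
  refine Fintype.prod_equiv e _ _ ?_
  intro x
  rw [minimalPeriod_permCongr]

theorem Tt_congr {α β : Type} [Fintype α] [Fintype β] [DecidableEq α] [DecidableEq β] (e : α ≃ β) (x : α) (k : ℕ) (g : ℕ → ℝ) :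
    Tt α x k g = Tt β (e x) k g := by
  unfold Tt
  refine Fintype.sum_equiv e.permCongr _ _ ?_
  intro σ
  rw [minimalPeriod_permCongr]
  congr 1
  refine Fintype.prod_equiv e _ _ ?_
  intro y
  simp only [minimalPeriod_permCongr, sameCycle_permCongr]

theorem card_sameCycle {α : Type} [Fintype α] [DecidableEq α] (σ : Equiv.Perm α) (x : α)
    [DecidablePred (Equiv.Perm.SameCycle σ x)] :
    (Finset.univ.filter (Equiv.Perm.SameCycle σ x)).card = Function.minimalPeriod σ x := by
  have : Finset.univ.filter (Equiv.Perm.SameCycle σ x) =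
      (Finset.range (Function.minimalPeriod σ x)).image (fun n => σ^[n] x) := by
    ext y
    simp only [Finset.mem_filter, Finset.mem_univ, true_and, Finset.mem_image, Finset.mem_range]
    constructor
    · intro h
      obtain ⟨n, hn⟩ := h.exists_nat_pow_eq
      refine ⟨n % Function.minimalPeriod σ x, Nat.mod_lt _ ?_, ?_⟩
      · apply Function.minimalPeriod_pos_of_mem_periodicPts
        exact Function.Injective.mem_periodicPts σ.injective x
      · rw [Function.iterate_mod_minimalPeriod_eq, ← hn, Equiv.Perm.iterate_eq_pow]
    · rintro ⟨n, _, rfl⟩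
      exact ⟨n, by rw [Equiv.Perm.iterate_eq_pow]; simp⟩
  rw [this, Finset.card_image_of_injOn, Finset.card_range]
  intro a ha b hb h
  simp only [Finset.coe_range, Set.mem_Iio] at ha hb
  exact Function.iterate_injOn_Iio_minimalPeriod ha hb h

theorem minPer_pos {α : Type} [Finite α] (σ : Equiv.Perm α) (x : α) :
    0 < Function.minimalPeriod σ x :=
  Function.minimalPeriod_pos_of_mem_periodicPts (Function.Injective.mem_periodicPts σ.injective x)

theorem minPer_le {α : Type} [Fintype α] (σ : Equiv.Perm α) (x : α) :
    Function.minimalPeriod σ x ≤ Fintype.card α := by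
  classical
  rw [← card_sameCycle]
  exact Finset.card_le_univ _

theorem minPer_sameCycle {α : Type} {σ : Equiv.Perm α} {x y : α} (h : σ.SameCycle x y) :
    Function.minimalPeriod σ y = Function.minimalPeriod σ x := by
  obtain ⟨n, rfl⟩ := h
  apply Function.minimalPeriod_eq_minimalPeriod_iff.2
  intro m
  rw [Function.IsPeriodicPt, Function.IsPeriodicPt, Function.IsFixedPt, Function.IsFixedPt,
    Equiv.Perm.iterate_eq_pow, ← Equiv.Perm.mul_apply, ← zpow_natCast, ← zpow_add, add_comm, zpow_add,
    Equiv.Perm.mul_apply]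
  exact (σ^n).injective.eq_iff

theorem Wt_eq_sum_Tt {α : Type} [Fintype α] [DecidableEq α] (x : α) (g : ℕ → ℝ) :
    Wt α g = ∑ k ∈ Finset.Icc 1 (Fintype.card α), g k ^ k * Tt α x k g := by
  unfold Wt Tt
  simp_rw [Finset.mul_sum]
  rw [Finset.sum_comm]
  apply Finset.sum_congr rfl
  intro σ _
  rw [Finset.sum_eq_single (Function.minimalPeriod σ x)]
  · rw [if_pos rfl]
    nth_rw 2 [← card_sameCycle σ x]
    rw [← Finset.prod_const, Finset.prod_filter, ← Finset.prod_mul_distrib]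
    apply Finset.prod_congr rfl
    intro i _
    by_cases h : σ.SameCycle x i
    · simp [h, minPer_sameCycle h]
    · simp [h]
  · intro k _ hk
    rw [if_neg (Ne.symm hk), mul_zero]
  · intro h
    exfalso; apply h
    simp only [Finset.mem_Icc]
    exact ⟨minPer_pos σ x, minPer_le σ x⟩

section insertion
variable {α : Type} [DecidableEq α]

/-- insertion of a new point. -/
def insP (x : α) (τ : Equiv.Perm α) : Equiv.Perm (Option α) :=
  Equiv.swap none (some x) * Equiv.optionCongr τ

theorem insP_none (x : α) (τ : Equiv.Perm α) : insP x τ none = some x := by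
  simp [insP]

theorem insP_some (x : α) (τ : Equiv.Perm α) (y : α) :
    insP x τ (some y) = if τ y = x then none else some (τ y) := by
  simp only [insP, Equiv.Perm.mul_apply, Equiv.optionCongr_apply, Option.map_some]
  split_ifs with h
  · rw [h]; simp
  · rw [Equiv.swap_apply_of_ne_of_ne] <;> simp [h]

theorem insP_iter_none (x : α) (τ : Equiv.Perm α) (j : ℕ) (hj : j < Function.minimalPeriod τ x) :
    (insP x τ)^[j+1] none = some (τ^[j] x) := by
  induction j with
  | zero => simp [insP_none]
  | succ j ih =>
    rw [Function.iterate_succ_apply', ih (by omega), insP_some, if_neg]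
    · rw [Function.iterate_succ_apply']
    · rw [← Function.iterate_succ_apply' τ]
      exact Function.not_isPeriodicPt_of_pos_of_lt_minimalPeriod (by omega) hj

theorem insP_per_none [Finite α] (x : α) (τ : Equiv.Perm α) :
    Function.minimalPeriod (insP x τ) none = Function.minimalPeriod τ x + 1 := by
  set k := Function.minimalPeriod τ x with hk
  have hk0 : 0 < k := minPer_pos τ x
  have h1 : (insP x τ)^[k+1] none = none := by
    obtain ⟨j, hj⟩ : ∃ j, k = j + 1 := ⟨k-1, by omega⟩
    rw [hj, Function.iterate_succ_apply', insP_iter_none _ _ _ (by omega), insP_some, if_pos]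
    have : τ^[k] x = x := Function.iterate_minimalPeriod
    rwa [hj, Function.iterate_succ_apply'] at this
  apply le_antisymm
  · exact Function.IsPeriodicPt.minimalPeriod_le (by omega) h1
  · by_contra hlt
    push Not at hlt
    have hp := minPer_pos (insP x τ) none
    have h2 : (insP x τ)^[Function.minimalPeriod (insP x τ) none] none = none :=
      Function.iterate_minimalPeriod
    obtain ⟨j, hj⟩ : ∃ j, Function.minimalPeriod (insP x τ) none = j + 1 :=
      ⟨Function.minimalPeriod (insP x τ) none - 1, by omega⟩
    rw [hj, insP_iter_none _ _ _ (by omega)] at h2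
    simp at h2

theorem insP_iter_some (x : α) (τ : Equiv.Perm α) (y : α) (h : ¬ τ.SameCycle x y) (n : ℕ) :
    (insP x τ)^[n] (some y) = some (τ^[n] y) := by
  induction n with
  | zero => rfl
  | succ n ih =>
    rw [Function.iterate_succ_apply', ih, insP_some, if_neg, Function.iterate_succ_apply']
    intro h'
    apply h
    rw [← Function.iterate_succ_apply' τ, Equiv.Perm.iterate_eq_pow] at h'
    exact Equiv.Perm.SameCycle.symm ⟨(n+1 : ℕ), by rw [zpow_natCast]; exact h'⟩

theorem insP_sameCycle [Finite α] (x : α) (τ : Equiv.Perm α) (y : α) :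
    (insP x τ).SameCycle none (some y) ↔ τ.SameCycle x y := by
  constructor
  · intro h
    by_contra hn
    obtain ⟨n, hh⟩ := h.symm.exists_nat_pow_eq
    rw [← Equiv.Perm.iterate_eq_pow, insP_iter_some x τ y hn] at hh
    simp at hh
  · intro h
    obtain ⟨n, hn⟩ := h.exists_nat_pow_eq
    rw [← Equiv.Perm.iterate_eq_pow, ← Function.iterate_mod_minimalPeriod_eq] at hn
    have := insP_iter_none x τ (n % Function.minimalPeriod τ x) (Nat.mod_lt _ (minPer_pos τ x))
    rw [hn, Equiv.Perm.iterate_eq_pow] at this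
    exact ⟨_, by rw [zpow_natCast]; exact this⟩

theorem insP_per_some (x : α) (τ : Equiv.Perm α) (y : α) (h : ¬ τ.SameCycle x y) :
    Function.minimalPeriod (insP x τ) (some y) = Function.minimalPeriod τ y := by
  apply Function.minimalPeriod_eq_minimalPeriod_iff.2
  intro n
  simp [Function.IsPeriodicPt, Function.IsFixedPt, insP_iter_some x τ y h]

theorem optC_iter (τ : Equiv.Perm α) (y : α) (n : ℕ) :
    (Equiv.optionCongr τ)^[n] (some y) = some (τ^[n] y) := by
  induction n with
  | zero => rfl
  | succ n ih =>
    rw [Function.iterate_succ_apply', ih, Function.iterate_succ_apply']; simp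

theorem optC_per_some (τ : Equiv.Perm α) (y : α) :
    Function.minimalPeriod (Equiv.optionCongr τ) (some y) = Function.minimalPeriod τ y := by
  apply Function.minimalPeriod_eq_minimalPeriod_iff.2
  intro n
  simp [Function.IsPeriodicPt, Function.IsFixedPt, optC_iter τ y]

theorem optC_per_none (τ : Equiv.Perm α) :
    Function.minimalPeriod (Equiv.optionCongr τ) none = 1 := by
  rw [Function.minimalPeriod_eq_one_iff_isFixedPt]
  simp [Function.IsFixedPt]

theorem optC_sameCycle (τ : Equiv.Perm α) (y : α) :
    ¬ (Equiv.Perm.SameCycle (Equiv.optionCongr τ : Equiv.Perm (Option α)) none (some y)) := by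
  intro h
  have h1 : (Equiv.optionCongr τ : Equiv.Perm (Option α)) none = none := by simp
  have := (Equiv.Perm.SameCycle.apply_eq_self_iff h).1 h1
  obtain ⟨n, hn⟩ := h
  rw [Equiv.Perm.zpow_apply_eq_self_of_apply_eq_self h1] at hn
  simp at hn

theorem sum_perm_option [Fintype α] (F : Equiv.Perm (Option α) → ℝ) :
    ∑ σ, F σ = ∑ τ : Equiv.Perm α, F (Equiv.optionCongr τ) + ∑ x : α, ∑ τ : Equiv.Perm α, F (insP x τ) := by
  rw [← (Equiv.Perm.decomposeOption (α := α)).symm.sum_comp, Fintype.sum_prod_type, Fintype.sum_option]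
  congr 1
  · apply Finset.sum_congr rfl
    intro τ _
    simp only [Equiv.Perm.decomposeOption_symm_apply, Equiv.swap_self]
    congr 1

end insertion

theorem Tt_option_one {α : Type} [Fintype α] [DecidableEq α] (g : ℕ → ℝ) :
    Tt (Option α) none 1 g = Wt α g := by
  unfold Tt Wt
  have := sum_perm_option (α := α) fun σ => if Function.minimalPeriod σ none = 1 then
    ∏ i, (if Equiv.Perm.SameCycle σ none i then 1 else g (Function.minimalPeriod σ i)) else 0
  have h2 : ∀ x : α, ∀ τ : Equiv.Perm α, ¬ (Function.minimalPeriod (insP x τ) none = 1) := by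
    intro x τ
    rw [insP_per_none]
    have := minPer_pos τ x
    omega
  simp only [h2, if_false, Finset.sum_const_zero, add_zero] at this
  rw [this]
  apply Finset.sum_congr rfl
  intro τ _
  rw [if_pos (optC_per_none τ), Fintype.prod_option]
  have h3 : Equiv.Perm.SameCycle (Equiv.optionCongr τ : Equiv.Perm (Option α)) none none :=
    Equiv.Perm.SameCycle.refl _ _
  simp [optC_sameCycle, optC_per_some, h3]

theorem Tt_option_succ {α : Type} [Fintype α] [DecidableEq α] (k : ℕ) (hk : 1 ≤ k) (g : ℕ → ℝ) :
    Tt (Option α) none (k+1) g = ∑ x : α, Tt α x k g := by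
  unfold Tt
  have := sum_perm_option (α := α) fun σ => if Function.minimalPeriod σ none = k+1 then
    ∏ i, (if Equiv.Perm.SameCycle σ none i then 1 else g (Function.minimalPeriod σ i)) else 0
  have h2 : ∀ τ : Equiv.Perm α, ¬ (Function.minimalPeriod (Equiv.optionCongr τ) none = k+1) := by
    intro τ
    rw [optC_per_none]
    omega
  simp only [h2, if_false, Finset.sum_const_zero, zero_add] at this
  rw [this]
  apply Finset.sum_congr rfl
  intro x _
  apply Finset.sum_congr rfl
  intro τ _
  rw [insP_per_none, Fintype.prod_option]
  simp only [Nat.add_right_cancel_iff, Equiv.Perm.SameCycle.refl, if_true, one_mul, insP_sameCycle]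
  congr 1
  apply Finset.prod_congr rfl
  intro i _
  by_cases h : τ.SameCycle x i
  · simp [h]
  · simp [h, insP_per_some x τ i h]

/-- normalized weights. -/
def aW (g : ℕ → ℝ) (N : ℕ) : ℝ := Wt (Fin N) g / (N.factorial : ℝ)

theorem Tt_fin (g : ℕ → ℝ) (k : ℕ) : ∀ n, k ≤ n →
    Tt (Option (Fin n)) none (k+1) g = n.factorial * aW g (n - k) := by
  induction k with
  | zero =>
    intro n _
    rw [Tt_option_one, aW, Nat.sub_zero]
    have : (n.factorial : ℝ) ≠ 0 := by positivity
    field_simp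
  | succ k ih =>
    intro n hn
    obtain ⟨m, rfl⟩ : ∃ m, n = m + 1 := ⟨n-1, by omega⟩
    rw [Tt_option_succ _ (by omega)]
    have : ∀ x : Fin (m+1), Tt (Fin (m+1)) x (k+1) g = m.factorial * aW g (m - k) := by
      intro x
      rw [Tt_congr (finSuccEquiv' x), ← ih m (by omega)]
      simp
    simp only [this]
    rw [Finset.sum_const, Finset.card_univ, Fintype.card_fin, Nat.factorial_succ]
    simp
    ring

theorem aW_zero (g : ℕ → ℝ) : aW g 0 = 1 := by
  simp [aW, Wt]

theorem aW_rec (g : ℕ → ℝ) (n : ℕ) :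
    ((n:ℝ)+1) * aW g (n+1) = ∑ k ∈ Finset.range (n+1), g (k+1) ^ (k+1) * aW g (n - k) := by
  rw [aW, Wt_congr (finSuccEquiv n), Wt_eq_sum_Tt none]
  simp only [Fintype.card_option, Fintype.card_fin]
  rw [← Finset.Ico_add_one_right_eq_Icc, Finset.sum_Ico_eq_sum_range, Nat.factorial_succ]
  have h1 : (n.factorial : ℝ) ≠ 0 := by positivity
  have h2 : (n:ℝ) + 1 ≠ 0 := by positivity
  have h3 : ∀ k ∈ Finset.range (n + 1 + 1 - 1), g (1 + k) ^ (1 + k) * Tt (Option (Fin n)) none (1 + k) g =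
      n.factorial * (g (k+1) ^ (k+1) * aW g (n - k)) := by
    intro k hk
    rw [Finset.mem_range] at hk
    rw [add_comm 1 k, Tt_fin g k n (by omega)]
    ring
  rw [Finset.sum_congr rfl h3, ← Finset.mul_sum]
  push_cast
  field_simp

theorem aW_ps (g : ℕ → ℝ) :
    PowerSeries.X * PowerSeries.derivative ℝ (PowerSeries.mk (aW g)) =
      PowerSeries.mk (fun k => if k = 0 then 0 else g k ^ k) * PowerSeries.mk (aW g) := by
  ext n
  rw [psD_coeff, PowerSeries.coeff_mul]
  simp only [PowerSeries.coeff_mk]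
  cases n with
  | zero => simp
  | succ n =>
    push_cast
    rw [aW_rec, Finset.Nat.sum_antidiagonal_eq_sum_range_succ_mk, Finset.sum_range_succ' _ (n+1)]
    simp

open Classical in
theorem permSet_lower (A : Set ℕ)
    (hs : Summable ((Aᶜ : Set ℕ).indicator fun j => (1 : ℝ) / j)) :
    ∃ c : ℝ, 0 < c ∧ ∃ N0 : ℕ, ∀ N ≥ N0,
      c * (N.factorial : ℝ) ≤ ((Finset.univ.filter fun σ => σ ∈ permSet A N).card : ℝ) := by
  set g : ℕ → ℝ := fun k => if k ∈ A then 1 else 0 with hg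
  obtain ⟨l, hl0, hl⟩ := rec_lower (fun k => if k = 0 then 0 else g k ^ k) (aW g) (by simp) (by
    intro j
    show (if j = 0 then (0:ℝ) else g j ^ j) ≤ 1
    split_ifs
    · norm_num
    · simp only [hg]; split_ifs
      · simp
      · rw [zero_pow (by assumption)]; norm_num) (by
    refine hs.congr ?_
    intro j
    rcases eq_or_ne j 0 with rfl | h
    · simp [Set.indicator]
    · by_cases hj : j ∈ A
      · simp [hg, h, hj]
      · simp [hg, h, hj]) (aW_ps g) (aW_zero g)
  have hcard : ∀ N, Wt (Fin N) g = ((Finset.univ.filter fun σ => σ ∈ permSet A N).card : ℝ) := by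
    intro N
    rw [Wt, Finset.card_filter]
    push_cast
    apply Finset.sum_congr rfl
    intro σ _
    by_cases h : σ ∈ permSet A N
    · rw [if_pos h]
      apply Finset.prod_eq_one
      intro i _
      exact if_pos (h i)
    · rw [if_neg h]
      have h' : ¬ ∀ i, Function.minimalPeriod σ i ∈ A := h
      push Not at h'
      obtain ⟨i, hi⟩ := h'
      apply Finset.prod_eq_zero (Finset.mem_univ i)
      exact if_neg hi
  have ha0 : ∀ N, 0 ≤ aW g N := by
    intro N
    rw [aW, hcard]; positivity
  have hlp : 0 < l := lt_of_le_of_ne (ge_of_tendsto' hl ha0) (Ne.symm hl0)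
  obtain ⟨N0, hN0⟩ := eventually_atTop.1 (hl.eventually (lt_mem_nhds (half_lt_self hlp)))
  refine ⟨l/2, by positivity, N0, fun N hN => ?_⟩
  have := hN0 N hN
  rw [aW, hcard, lt_div_iff₀ (by positivity)] at this
  exact this.le

open Classical in
theorem two_pow_fix_bound (E : ℕ) (hE : 0 < E) :
    ∃ C : ℝ, 0 ≤ C ∧ ∀ N : ℕ, ∑ σ : Equiv.Perm (Fin N),
      (2:ℝ) ^ (Finset.univ.filter fun i => (σ ^ E) i = i).card ≤ C * N.factorial := by
  set g : ℕ → ℝ := fun k => if k ∣ E then 2 else 1 with hg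
  obtain ⟨l, hl⟩ := rec_conv (fun k => if k = 0 then 0 else g k ^ k) (aW g) (by simp) (by
    apply summable_of_ne_finset_zero (s := Finset.range (E+1))
    intro j hj
    have hj' : E < j := by simpa using hj
    have : ¬ j ∣ E := fun h => absurd (Nat.le_of_dvd hE h) (by omega)
    simp [hg, this, show j ≠ 0 by omega]) (aW_ps g) (aW_zero g)
  obtain ⟨C, hC⟩ := (Metric.isBounded_range_of_tendsto _ hl).exists_norm_le
  have hC' : ∀ N, |aW g N| ≤ C := fun n => hC _ ⟨n, rfl⟩
  refine ⟨C, (abs_nonneg _).trans (hC' 0), fun N => ?_⟩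
  have h := (le_abs_self _).trans (hC' N)
  rw [aW, div_le_iff₀ (by positivity)] at h
  refine le_trans (le_of_eq ?_) h
  rw [Wt]
  apply Finset.sum_congr rfl
  intro σ _
  rw [← Finset.prod_const, Finset.prod_filter]
  apply Finset.prod_congr rfl
  intro i _
  have : (σ ^ E) i = i ↔ Function.minimalPeriod σ i ∣ E := by
    rw [← Function.isPeriodicPt_iff_minimalPeriod_dvd, Function.IsPeriodicPt, Function.IsFixedPt,
      Equiv.Perm.iterate_eq_pow]
  simp only [hg, this]

open Classical in
theorem moment_inf (A : Set ℕ)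
    (hs : Summable ((Aᶜ : Set ℕ).indicator fun j => (1 : ℝ) / j)) (E : ℕ) (hE : 0 < E) :
    ∃ C : ℝ, 0 ≤ C ∧ ∃ N0 : ℕ, ∀ N ≥ N0,
      ∑ σ ∈ Finset.univ.filter (fun σ => σ ∈ permSet A N),
        (2:ℝ) ^ (Finset.univ.filter fun i => (σ ^ E) i = i).card ≤
      C * ((Finset.univ.filter fun σ => σ ∈ permSet A N).card : ℝ) := by
  obtain ⟨c, hc, N0, h1⟩ := permSet_lower A hs
  obtain ⟨C, hC, h2⟩ := two_pow_fix_bound E hE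
  refine ⟨C / c, by positivity, N0, fun N hN => ?_⟩
  calc _ ≤ ∑ σ : Equiv.Perm (Fin N),
      (2:ℝ) ^ (Finset.univ.filter fun i => (σ ^ E) i = i).card := by
        apply Finset.sum_le_sum_of_subset_of_nonneg (Finset.filter_subset _ _)
        intro _ _ _; positivity
    _ ≤ C * N.factorial := h2 N
    _ = C / c * (c * N.factorial) := by field_simp
    _ ≤ _ := by
      apply mul_le_mul_of_nonneg_left (h1 N hN); positivity

open Classical in
theorem exists_perm_emb {V : Type} {N : ℕ} (y y' : V ↪ Fin N) :
    ∃ π : Equiv.Perm (Fin N), ∀ v, π (y v) = y' v := by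
  let e : {x // x ∈ Set.range y} ≃ {x // x ∈ Set.range y'} :=
    (Equiv.ofInjective y y.injective).symm.trans (Equiv.ofInjective y' y'.injective)
  refine ⟨e.extendSubtype, fun v => ?_⟩
  rw [Equiv.extendSubtype_apply_of_mem e (y v) ⟨v, rfl⟩]
  simp only [e, Equiv.trans_apply]
  rw [Equiv.ofInjective_symm_apply]
  rfl

section single
variable {T V : Type} [Fintype T] [Fintype V] {N : ℕ}

/-- relations imposed on a single permutation. -/
def relP (p : T → Prop) (e : T → ℤ) (a b : T → V) (σ : Equiv.Perm (Fin N)) (y : V → Fin N) : Prop :=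
  ∀ t, p t → (σ ^ (e t)) (y (b t)) = y (a t)

theorem relP_conj (p : T → Prop) (e : T → ℤ) (a b : T → V) (σ π : Equiv.Perm (Fin N)) (y y' : V → Fin N)
    (h : ∀ v, π (y v) = y' v) (hr : relP p e a b σ y) : relP p e a b (π * σ * π⁻¹) y' := by
  intro t ht
  rw [conj_zpow, ← h, ← h]
  simp [hr t ht]

open Classical in
theorem sym_count (p : T → Prop) (e : T → ℤ) (a b : T → V) (Ω : Finset (Equiv.Perm (Fin N)))
    (hΩ : ∀ π σ, σ ∈ Ω → π * σ * π⁻¹ ∈ Ω) (y : V ↪ Fin N) :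
    (Ω.filter fun σ => relP p e a b σ y).card * N.descFactorial (Fintype.card V) ≤
      ∑ σ ∈ Ω, (Finset.univ.filter fun z : V → Fin N => relP p e a b σ z).card := by
  have h1 : ∀ y' : V ↪ Fin N, (Ω.filter fun σ => relP p e a b σ y).card ≤
      (Ω.filter fun σ => relP p e a b σ y').card := by
    intro y'
    obtain ⟨π, hπ⟩ := exists_perm_emb y y'
    apply Finset.card_le_card_of_injOn (fun σ => π * σ * π⁻¹)
    · intro σ hσ
      simp only [Finset.coe_filter, Set.mem_ofPred_eq] at hσ ⊢
      exact ⟨hΩ _ _ hσ.1, relP_conj p e a b σ π y y' hπ hσ.2⟩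
    · intro σ _ τ _ h
      simpa using h
  calc _ = ∑ y' : V ↪ Fin N, (Ω.filter fun σ => relP p e a b σ y).card := by
        rw [Finset.sum_const, Finset.card_univ, Fintype.card_embedding_eq, Fintype.card_fin, smul_eq_mul, mul_comm]
    _ ≤ ∑ y' : V ↪ Fin N, (Ω.filter fun σ => relP p e a b σ y').card := Finset.sum_le_sum fun y' _ => h1 y'
    _ = ∑ σ ∈ Ω, (Finset.univ.filter fun z : V ↪ Fin N => relP p e a b σ z).card := by
        simp_rw [Finset.card_filter]
        rw [Finset.sum_comm]
    _ ≤ _ := by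
        apply Finset.sum_le_sum
        intro σ _
        apply Finset.card_le_card_of_injOn (fun z : V ↪ Fin N => (z : V → Fin N))
        · intro z hz
          simpa using hz
        · intro z _ z' _ h
          exact DFunLike.coe_injective h

/-- The classes. -/
def clS (p : T → Prop) (a b : T → V) : Setoid V :=
  Relation.EqvGen.setoid fun v w => ∃ t, p t ∧ a t = v ∧ b t = w

/-- free class. -/
def freeC (p : T → Prop) (a b : T → V) (c : Quotient (clS p a b)) : Prop :=
  ¬ ∃ t, p t ∧ a t = b t ∧ Quotient.mk (clS p a b) (a t) = c

/-- number of free classes. -/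
def nfree (p : T → Prop) (a b : T → V) : ℕ := Nat.card {c // freeC p a b c}

open Classical in
/-- number of fixed points of the powers. -/
def fixF (p : T → Prop) (e : T → ℤ) (σ : Equiv.Perm (Fin N)) : ℕ :=
  ∑ t ∈ Finset.univ.filter p, (Finset.univ.filter fun i => (σ ^ (e t)) i = i).card

theorem relP_eq_of_class (p : T → Prop) (e : T → ℤ) (a b : T → V) (σ : Equiv.Perm (Fin N))
    (y z : V → Fin N) (hy : relP p e a b σ y) (hz : relP p e a b σ z) (v w : V)
    (h : Relation.EqvGen (fun v w => ∃ t, p t ∧ a t = v ∧ b t = w) v w) : y v = z v ↔ y w = z w := by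
  induction h with
  | rel x y' h =>
    obtain ⟨t, ht, rfl, rfl⟩ := h
    rw [← hy t ht, ← hz t ht]
    exact (σ ^ e t).injective.eq_iff
  | refl x => exact Iff.rfl
  | symm x y' _ ih => exact ih.symm
  | trans x y' z' _ _ ih1 ih2 => exact ih1.trans ih2

open Classical in
theorem sol_count (p : T → Prop) (e : T → ℤ) (a b : T → V) (σ : Equiv.Perm (Fin N)) :
    (Finset.univ.filter fun z : V → Fin N => relP p e a b σ z).card ≤
      N ^ (nfree p a b) * (1 + fixF p e σ) ^ (Fintype.card V) := by
  have hrep : ∀ c : Quotient (clS p a b), ∃ v, Quotient.mk _ v = c ∧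
      (freeC p a b c ∨ ∃ t, p t ∧ a t = b t ∧ a t = v) := by
    intro c
    by_cases h : freeC p a b c
    · exact ⟨c.out, Quotient.out_eq c, Or.inl h⟩
    · have h' := h
      rw [freeC, not_not] at h
      obtain ⟨t, h1, h2, h3⟩ := h
      exact ⟨a t, h3, Or.inr ⟨t, h1, h2, rfl⟩⟩
  choose rep hrep1 hrep2 using hrep
  set D : Quotient (clS p a b) → Finset (Fin N) := fun c =>
    if freeC p a b c then Finset.univ else
      (Finset.univ.filter fun i => ∃ t, p t ∧ (σ ^ (e t)) i = i) with hD
  have h1 : (Finset.univ.filter fun z : V → Fin N => relP p e a b σ z).card ≤ (Fintype.piFinset D).card := by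
    apply Finset.card_le_card_of_injOn (fun z c => z (rep c))
    · intro z hz
      have hz' : relP p e a b σ z := by simpa using hz
      simp only [Finset.mem_coe, Fintype.mem_piFinset]
      intro c
      simp only [hD]
      split_ifs with h
      · exact Finset.mem_univ _
      · obtain ⟨t, ht, hab, hv⟩ := (hrep2 c).resolve_left h
        simp only [Finset.mem_filter, Finset.mem_univ, true_and]
        refine ⟨t, ht, ?_⟩
        have := hz' t ht
        rw [← hab, hv] at this
        exact this
    · intro y hy z hz h
      have hy' : relP p e a b σ y := by simpa using hy
      have hz' : relP p e a b σ z := by simpa using hz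
      funext v
      have hc := hrep1 (Quotient.mk _ v)
      have hr : Relation.EqvGen (fun v w => ∃ t, p t ∧ a t = v ∧ b t = w) (rep (Quotient.mk _ v)) v :=
        Quotient.exact hc
      exact (relP_eq_of_class p e a b σ y z hy' hz' _ _ hr).1 (congrFun h _)
  have h2 : (Finset.univ.filter fun i => ∃ t, p t ∧ (σ ^ (e t)) i = i).card ≤ fixF p e σ := by
    have : (Finset.univ.filter fun i => ∃ t, p t ∧ (σ ^ (e t)) i = i) =
        (Finset.univ.filter p).biUnion fun t => Finset.univ.filter fun i => (σ ^ (e t)) i = i := by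
      ext i; simp
    rw [this]
    exact Finset.card_biUnion_le
  have h3 : (Fintype.piFinset D).card ≤ ∏ c : Quotient (clS p a b),
      ((if freeC p a b c then N else 1) * (1 + fixF p e σ)) := by
    rw [Fintype.card_piFinset]
    apply Finset.prod_le_prod' 
    intro c _
    simp only [hD]
    split_ifs
    · simp only [Finset.card_univ, Fintype.card_fin]
      exact Nat.le_mul_of_pos_right _ (by omega)
    · omega
  refine (h1.trans h3).trans ?_
  rw [Finset.prod_mul_distrib, Finset.prod_const, Finset.prod_ite, Finset.prod_const, Finset.prod_const_one, mul_one]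
  have h4 : (Finset.univ.filter fun c => freeC p a b c).card = nfree p a b := by
    rw [nfree, Nat.card_eq_fintype_card, Fintype.card_subtype]
  rw [h4]
  apply Nat.mul_le_mul_left
  apply Nat.pow_le_pow_right (by omega)
  rw [Finset.card_univ]
  exact Fintype.card_le_of_surjective _ (Quotient.mk_surjective)

open Classical in
theorem nfree_bound (p : T → Prop) (a b : T → V) :
    2 * nfree p a b ≤ Fintype.card V +
      (Finset.univ.filter fun v => ¬ ∃ t, p t ∧ (a t = v ∨ b t = v)).card := by
  have h4 : (Finset.univ.filter fun c => freeC p a b c).card = nfree p a b := by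
    rw [nfree, Nat.card_eq_fintype_card, Fintype.card_subtype]
  have h5 : Fintype.card V +
      (Finset.univ.filter fun v => ¬ ∃ t, p t ∧ (a t = v ∨ b t = v)).card =
      ∑ v : V, (1 + if ¬ ∃ t, p t ∧ (a t = v ∨ b t = v) then 1 else 0) := by
    rw [Finset.sum_add_distrib, Finset.card_filter]; simp
  rw [h5, ← h4, ← Finset.sum_fiberwise (g := fun v => Quotient.mk (clS p a b) v), mul_comm, ← smul_eq_mul, ← Finset.sum_const]
  refine le_trans ?_ (Finset.sum_le_sum_of_subset (Finset.filter_subset (fun c => freeC p a b c) _))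
  apply Finset.sum_le_sum
  intro c hc
  have hfree : freeC p a b c := by simpa using hc
  obtain ⟨v, rfl⟩ := Quotient.mk_surjective c
  by_cases hv : ∃ t, p t ∧ (a t = v ∨ b t = v)
  · -- another element of the class
    obtain ⟨w, hwv, hw⟩ : ∃ w, w ≠ v ∧ Quotient.mk (clS p a b) w = Quotient.mk (clS p a b) v := by
      obtain ⟨t, ht, h⟩ := hv
      have hrel : Quotient.mk (clS p a b) (a t) = Quotient.mk (clS p a b) (b t) :=
        Quotient.sound (Relation.EqvGen.rel _ _ ⟨t, ht, rfl, rfl⟩)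
      rcases h with h | h
      · refine ⟨b t, fun hb => hfree ⟨t, ht, by rw [h, hb], by rw [h]⟩, ?_⟩
        rw [← hrel, h]
      · refine ⟨a t, fun hb => hfree ⟨t, ht, by rw [h, hb], by rw [hb]⟩, ?_⟩
        rw [hrel, h]
    calc 2 = ∑ v' ∈ ({w, v} : Finset V), 1 := by rw [Finset.sum_const, Finset.card_pair hwv]; rfl
      _ ≤ ∑ v' ∈ Finset.univ.filter (fun v' => Quotient.mk (clS p a b) v' = Quotient.mk (clS p a b) v), 1 := by
          apply Finset.sum_le_sum_of_subset
          intro x hx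
          simp only [Finset.mem_insert, Finset.mem_singleton] at hx
          rcases hx with rfl | rfl
          · simpa using hw
          · simp
      _ ≤ _ := Finset.sum_le_sum fun _ _ => Nat.le_add_right _ _
  · refine le_trans ?_ (Finset.single_le_sum (f := fun v => 1 + if ¬ ∃ t, p t ∧ (a t = v ∨ b t = v) then 1 else 0) (fun _ _ => Nat.zero_le _) (a := v) (by simp))
    rw [if_pos hv]

end single

section multi
variable {s : ℕ} {T : Type} [Fintype T]

open Classical in
theorem exponent_bound {V : Type} [Fintype V] (nxt : T → T) (hnx : Function.Surjective nxt)
    (r : T → Fin s) (hne : ∀ t, r (nxt t) ≠ r t) (q : T → V) (hq : Function.Surjective q) :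
    ∑ i : Fin s, nfree (fun t => r t = i) q (fun t => q (nxt t)) + Fintype.card V ≤ s * Fintype.card V := by
  have h1 : ∑ i : Fin s, (Finset.univ.filter fun v => ¬ ∃ t, r t = i ∧ (q t = v ∨ q (nxt t) = v)).card +
      2 * Fintype.card V ≤ s * Fintype.card V := by
    simp_rw [Finset.card_filter]
    rw [Finset.sum_comm]
    have h2 : ∀ v : V, (∑ i : Fin s, if ¬ ∃ t, r t = i ∧ (q t = v ∨ q (nxt t) = v) then 1 else 0) + 2 ≤ s := by
      intro v
      obtain ⟨t, rfl⟩ := hq v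
      obtain ⟨t', rfl⟩ := hnx t
      rw [← Finset.card_filter]
      have hsub : (Finset.univ.filter fun i : Fin s => ¬ ∃ t, r t = i ∧ (q t = q (nxt t') ∨ q (nxt t) = q (nxt t'))) ⊆
          Finset.univ \ {r (nxt t'), r t'} := by
        intro i hi
        simp only [Finset.mem_filter, Finset.mem_univ, true_and] at hi
        simp only [Finset.mem_sdiff, Finset.mem_univ, true_and, Finset.mem_insert, Finset.mem_singleton]
        rintro (rfl | rfl)
        · exact hi ⟨_, rfl, Or.inl rfl⟩
        · exact hi ⟨_, rfl, Or.inr rfl⟩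
      have h3 := Finset.card_le_card hsub
      have h4 := Finset.card_sdiff_add_card_inter (Finset.univ : Finset (Fin s)) {r (nxt t'), r t'}
      rw [Finset.univ_inter, Finset.card_pair (hne t'), Finset.card_univ, Fintype.card_fin] at h4
      omega
    have h5 := Finset.sum_le_sum fun v (_ : v ∈ Finset.univ) => h2 v
    rw [Finset.sum_add_distrib, Finset.sum_const, Finset.sum_const, Finset.card_univ] at h5
    simp only [smul_eq_mul] at h5
    linarith
  have h2 := Finset.sum_le_sum fun i (_ : i ∈ Finset.univ) => nfree_bound (fun t => r t = i) q (fun t => q (nxt t))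
  rw [← Finset.mul_sum, Finset.sum_add_distrib, Finset.sum_const, Finset.card_univ, Fintype.card_fin, smul_eq_mul] at h2
  have h3 : 2 * ∑ i : Fin s, nfree (fun t => r t = i) q (fun t => q (nxt t)) ≤ s * Fintype.card V + 
     ∑ i : Fin s, (Finset.univ.filter fun v => ¬ ∃ t, r t = i ∧ (q t = v ∨ q (nxt t) = v)).card := by
    refine h2.trans_eq ?_
    congr 2
    funext x
    congr
  linarith

theorem descFact_lower (N v : ℕ) (h : 2 * v ≤ N) : N ^ v ≤ 2 ^ v * N.descFactorial v := by
  have h1 : ∀ k ≤ v, N ^ k ≤ 2 ^ k * N.descFactorial k := by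
    intro k
    induction k with
    | zero => simp
    | succ k ih =>
      intro hk
      rw [Nat.descFactorial_succ, pow_succ, pow_succ]
      calc N ^ k * N ≤ (2 ^ k * N.descFactorial k) * (2 * (N - k)) :=
            Nat.mul_le_mul (ih (by omega)) (by omega)
        _ = _ := by ring
  exact h1 v le_rfl

open Classical in
theorem pattern_bound {V : Type} [Fintype V] (nxt : T → T) (hnx : Function.Surjective nxt)
    (r : T → Fin s) (e : T → ℤ) (hne : ∀ t, r (nxt t) ≠ r t) (q : T → V) (hq : Function.Surjective q)
    (C : ℝ) (hs : 0 < s)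
    (N : ℕ) (hN : 2 * Fintype.card T ≤ N) (hN0 : 0 < N) (Ω : Fin s → Finset (Equiv.Perm (Fin N)))
    (hΩ : ∀ i π σ, σ ∈ Ω i → π * σ * π⁻¹ ∈ Ω i)
    (hM : ∀ i, ∑ σ ∈ Ω i, (1 + (fixF (fun t => r t = i) e σ : ℝ)) ^ (Fintype.card T) ≤ C * (Ω i).card) :
    ∑ y : V ↪ Fin N, ∏ i, (((Ω i).filter fun σ => relP (fun t => r t = i) e q (fun t => q (nxt t)) σ y).card : ℝ)
      ≤ 2 ^ (Fintype.card T * s) * C ^ s * ∏ i, ((Ω i).card : ℝ) := by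
  have hVT : Fintype.card V ≤ Fintype.card T := Fintype.card_le_of_surjective q hq
  set v := Fintype.card V
  set M : ℝ := (N.descFactorial v : ℝ) with hMdef
  have hMpos : 0 < M := by
    have : 0 < N.descFactorial v := Nat.descFactorial_pos.2 (by omega)
    rw [hMdef]; exact_mod_cast this
  set b : Fin s → ℕ := fun i => nfree (fun t => r t = i) q (fun t => q (nxt t)) with hb
  have hNr : (1:ℝ) ≤ N := by exact_mod_cast hN0
  have h1 : ∀ (y : V ↪ Fin N) i, (((Ω i).filter fun σ => relP (fun t => r t = i) e q (fun t => q (nxt t)) σ y).card : ℝ)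
      ≤ (N:ℝ) ^ (b i) * (C * (Ω i).card) / M := by
    intro y i
    rw [le_div_iff₀ hMpos]
    have h := sym_count (fun t => r t = i) e q (fun t => q (nxt t)) (Ω i) (hΩ i) y
    have h2 : ((∑ σ ∈ Ω i, (Finset.univ.filter fun z : V → Fin N => relP (fun t => r t = i) e q (fun t => q (nxt t)) σ z).card : ℕ) : ℝ)
        ≤ (N:ℝ) ^ (b i) * (C * (Ω i).card) := by
      push_cast
      calc _ ≤ ∑ σ ∈ Ω i, (N:ℝ) ^ (b i) * (1 + (fixF (fun t => r t = i) e σ : ℝ)) ^ (Fintype.card T) := by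
            apply Finset.sum_le_sum
            intro σ _
            have h3 := sol_count (fun t => r t = i) e q (fun t => q (nxt t)) σ
            have h4 : ((Finset.univ.filter fun z : V → Fin N => relP (fun t => r t = i) e q (fun t => q (nxt t)) σ z).card : ℝ)
              ≤ (N:ℝ) ^ (b i) * (1 + (fixF (fun t => r t = i) e σ : ℝ)) ^ v := by exact_mod_cast h3
            refine h4.trans ?_
            apply mul_le_mul_of_nonneg_left _ (by positivity)
            apply pow_le_pow_right₀ _ hVT
            simp
        _ = (N:ℝ) ^ (b i) * ∑ σ ∈ Ω i, (1 + (fixF (fun t => r t = i) e σ : ℝ)) ^ (Fintype.card T) := by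
            rw [Finset.mul_sum]
        _ ≤ _ := mul_le_mul_of_nonneg_left (hM i) (by positivity)
    refine le_trans ?_ h2
    rw [hMdef]
    exact_mod_cast h
  have hCn : ∀ i, 0 ≤ C * (Ω i).card := fun i => le_trans (Finset.sum_nonneg fun σ _ => by positivity) (hM i)
  calc _ ≤ ∑ y : V ↪ Fin N, ∏ i, ((N:ℝ) ^ (b i) * (C * (Ω i).card) / M) := by
        apply Finset.sum_le_sum
        intro y _
        apply Finset.prod_le_prod
        · intro i _; positivity
        · intro i _; exact h1 y i
    _ = M * ((N:ℝ) ^ (∑ i, b i) * (∏ i, (C * (Ω i).card)) / M ^ s) := by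
        rw [Finset.sum_const, Finset.card_univ, Fintype.card_embedding_eq, Fintype.card_fin, nsmul_eq_mul,
          Finset.prod_div_distrib, Finset.prod_mul_distrib, Finset.prod_pow_eq_pow_sum, Finset.prod_const, Finset.card_univ,
          Fintype.card_fin]
    _ = ((N:ℝ) ^ (∑ i, b i) * M / M ^ s) * ∏ i, (C * (Ω i).card) := by ring
    _ ≤ 2 ^ (Fintype.card T * s) * ∏ i, (C * (Ω i).card) := by
        apply mul_le_mul_of_nonneg_right
        · rw [div_le_iff₀ (by positivity)]
          have h5 := exponent_bound nxt hnx r hne q hq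
          have hle : M ≤ (N:ℝ) ^ v := by
            rw [hMdef]; exact_mod_cast Nat.descFactorial_le_pow N v
          have hlow : (N:ℝ) ^ v ≤ 2 ^ v * M := by
            rw [hMdef]; exact_mod_cast descFact_lower N v (by omega)
          calc (N:ℝ) ^ (∑ i, b i) * M ≤ (N:ℝ) ^ (∑ i, b i) * (N:ℝ) ^ v :=
                mul_le_mul_of_nonneg_left hle (by positivity)
            _ = (N:ℝ) ^ (∑ i, b i + v) := by rw [pow_add]
            _ ≤ (N:ℝ) ^ (v * s) := pow_le_pow_right₀ hNr (by rw [mul_comm v s]; exact h5)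
            _ = ((N:ℝ) ^ v) ^ s := by rw [pow_mul]
            _ ≤ (2 ^ v * M) ^ s := pow_le_pow_left₀ (by positivity) hlow s
            _ = 2 ^ (v * s) * M ^ s := by rw [mul_pow, pow_mul]
            _ ≤ _ := by
                apply mul_le_mul_of_nonneg_right _ (by positivity)
                apply pow_le_pow_right₀ (by norm_num)
                exact Nat.mul_le_mul_right _ hVT
        · exact Finset.prod_nonneg fun i _ => hCn i
    _ = _ := by
        rw [Finset.prod_mul_distrib, Finset.prod_const, Finset.card_univ, Fintype.card_fin, mul_assoc]

set_option maxHeartbeats 1000000 in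
open Classical in
/-- The main pattern theorem. -/
theorem pattern_main (nxt : T → T) (hnx : Function.Surjective nxt)
    (r : T → Fin s) (e : T → ℤ) (hne : ∀ t, r (nxt t) ≠ r t) (C : ℝ) (hC : 0 ≤ C) (hs : 0 < s) :
    ∃ K : ℝ, 0 ≤ K ∧ ∀ N : ℕ, 2 * Fintype.card T ≤ N → 0 < N → ∀ Ω : Fin s → Finset (Equiv.Perm (Fin N)),
    (∀ i π σ, σ ∈ Ω i → π * σ * π⁻¹ ∈ Ω i) →
    (∀ i, ∑ σ ∈ Ω i, (1 + (fixF (fun t => r t = i) e σ : ℝ)) ^ (Fintype.card T) ≤ C * (Ω i).card) →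
    ∑ σ ∈ Fintype.piFinset Ω, ((Finset.univ.filter fun x : T → Fin N =>
        ∀ t, ((σ (r t)) ^ (e t)) (x (nxt t)) = x t).card : ℝ) ≤ K * ∏ i, ((Ω i).card : ℝ) := by
  refine ⟨∑ v : Fin (Fintype.card T + 1), ∑ q : T → Fin v, 2 ^ (Fintype.card T * s) * C ^ s, by positivity, ?_⟩
  intro N hN hN0 Ω hΩ hM
  set f : (T → Fin N) → ℝ := fun x => ∏ i, (((Ω i).filter fun σ => relP (fun t => r t = i) e id nxt σ x).card : ℝ) with hf
  have hf0 : ∀ x, 0 ≤ f x := fun x => Finset.prod_nonneg fun i _ => by positivity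
  have h1 : ∑ σ ∈ Fintype.piFinset Ω, ((Finset.univ.filter fun x : T → Fin N =>
        ∀ t, ((σ (r t)) ^ (e t)) (x (nxt t)) = x t).card : ℝ) = ∑ x, f x := by
    simp_rw [Finset.card_filter]
    push_cast
    rw [Finset.sum_comm]
    apply Finset.sum_congr rfl
    intro x _
    simp only [hf]
    have h2 : ∏ i, (((Ω i).filter fun σ => relP (fun t => r t = i) e id nxt σ x).card : ℝ) =
        ((Fintype.piFinset fun i => (Ω i).filter fun σ => relP (fun t => r t = i) e id nxt σ x).card : ℝ) := by
      rw [Fintype.card_piFinset]; push_cast; rfl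
    rw [h2, ← Finset.sum_filter, Finset.sum_const, nsmul_eq_mul, mul_one]
    congr 2
    ext σ
    constructor
    · intro h
      obtain ⟨ha, hb⟩ := Finset.mem_filter.1 h
      rw [Fintype.mem_piFinset] at ha ⊢
      intro i
      refine Finset.mem_filter.2 ⟨ha i, ?_⟩
      rintro t rfl
      exact hb t
    · intro h
      rw [Fintype.mem_piFinset] at h
      refine Finset.mem_filter.2 ⟨Fintype.mem_piFinset.2 fun i => (Finset.mem_filter.1 (h i)).1, fun t => (Finset.mem_filter.1 (h (r t))).2 t rfl⟩
  rw [h1]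
  -- factorization
  have hfac : ∀ x : T → Fin N, ∃ (z : (v : Fin (Fintype.card T + 1)) × ((T → Fin v) × (Fin v ↪ Fin N))),
      (∀ t, z.2.2 (z.2.1 t) = x t) ∧ Function.Surjective z.2.1 := by
    intro x
    have hcard : Fintype.card (Set.range x) ≤ Fintype.card T := Fintype.card_range_le x
    let E := Fintype.equivFin (Set.range x)
    refine ⟨⟨⟨Fintype.card (Set.range x), by omega⟩, fun t => E ⟨x t, t, rfl⟩,
      E.symm.toEmbedding.trans (Function.Embedding.subtype _)⟩, ?_, ?_⟩
    · intro t; simp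
    · intro j
      obtain ⟨t, ht⟩ := (E.symm j).2
      refine ⟨t, ?_⟩
      simp only [ht]
      simp
  choose z hz1 hz2 using hfac
  have hzinj : Function.Injective z := by
    intro x x' h
    funext t
    rw [← hz1 x t, ← hz1 x' t, h]
  calc ∑ x, f x = ∑ x, (if Function.Surjective (z x).2.1 then f (fun t => (z x).2.2 ((z x).2.1 t)) else 0) := by
        apply Finset.sum_congr rfl
        intro x _
        rw [if_pos (hz2 x)]
        congr 1
        funext t
        exact (hz1 x t).symm
    _ = ∑ w ∈ Finset.univ.image z, (if Function.Surjective w.2.1 then f (fun t => w.2.2 (w.2.1 t)) else 0) := by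
        rw [Finset.sum_image (fun a _ b _ h => hzinj h)]
    _ ≤ ∑ w : (v : Fin (Fintype.card T + 1)) × ((T → Fin v) × (Fin v ↪ Fin N)), (if Function.Surjective w.2.1 then f (fun t => w.2.2 (w.2.1 t)) else 0) := by
        apply Finset.sum_le_sum_of_subset_of_nonneg (Finset.subset_univ _)
        intro w _ _
        split_ifs
        · exact hf0 _
        · exact le_rfl
    _ = ∑ v : Fin (Fintype.card T + 1), ∑ q : T → Fin v, ∑ y : Fin v ↪ Fin N,
          (if Function.Surjective q then f (fun t => y (q t)) else 0) := by
        rw [Fintype.sum_sigma]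
        apply Finset.sum_congr rfl
        intro v _
        rw [Fintype.sum_prod_type]
    _ ≤ ∑ v : Fin (Fintype.card T + 1), ∑ q : T → Fin v, (2 ^ (Fintype.card T * s) * C ^ s * ∏ i, ((Ω i).card : ℝ)) := by
        apply Finset.sum_le_sum
        intro v _
        apply Finset.sum_le_sum
        intro q _
        by_cases hq : Function.Surjective q
        · simp only [hq, if_true]
          exact pattern_bound nxt hnx r e hne q hq C hs N hN hN0 Ω hΩ hM
        · simp only [hq, if_false, Finset.sum_const_zero]
          exact mul_nonneg (mul_nonneg (pow_nonneg (by norm_num) _) (pow_nonneg hC _)) (Finset.prod_nonneg fun i _ => Nat.cast_nonneg _)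
    _ = _ := by
        simp only [Finset.sum_mul]

end multi

/-- evaluation of a word in a group -/
def evW {s : ℕ} {H : Type} [Group H] (v : Fin s → H) (w : List (Fin s × Bool)) : H :=
  (w.map fun p => if p.2 then v p.1 else (v p.1)⁻¹).prod

/-- evaluation of a syllable list in a group -/
def evL {s : ℕ} {H : Type} [Group H] (v : Fin s → H) (l : List (Fin s × ℤ)) : H :=
  (l.map fun p => v p.1 ^ p.2).prod

/-- `l` represents a conjugate of `w`. -/
def WRel {s : ℕ} (d : Fin s → ℕ∞) (w : List (Fin s × Bool)) (l : List (Fin s × ℤ)) : Prop :=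
  ∀ (H : Type) [Group H] (v : Fin s → H), (∀ r (m : ℕ), d r = (m : ℕ∞) → v r ^ m = 1) →
    IsConj (evW v w) (evL v l)

/-- the congruence -/
def wCon (s : ℕ) (d : Fin s → ℕ∞) : Con (FreeMonoid (Fin s × Bool)) where
  r := fun a b => WordEquiv s d a.toList b.toList
  iseqv := ⟨fun a => WordEquiv.refl _, fun h => WordEquiv.symm h, fun h h' => WordEquiv.trans h h'⟩
  mul' := fun h k => WordEquiv.mul h k

/-- class of a word -/
def wMk {s : ℕ} (d : Fin s → ℕ∞) (w : List (Fin s × Bool)) : (wCon s d).Quotient :=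
  ((FreeMonoid.ofList w : FreeMonoid (Fin s × Bool)) : (wCon s d).Quotient)

theorem wMk_eq {s : ℕ} (d : Fin s → ℕ∞) (w w' : List (Fin s × Bool)) :
    wMk d w = wMk d w' ↔ WordEquiv s d w w' := by
  rw [wMk, wMk, Con.eq]; exact Iff.rfl

theorem wMk_mul {s : ℕ} (d : Fin s → ℕ∞) (w w' : List (Fin s × Bool)) :
    wMk d w * wMk d w' = wMk d (w ++ w') := rfl

theorem wMk_one {s : ℕ} (d : Fin s → ℕ∞) : wMk d [] = 1 := rfl

/-- generator -/
def wU {s : ℕ} (d : Fin s → ℕ∞) (r : Fin s) : ((wCon s d).Quotient)ˣ where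
  val := wMk d [(r, true)]
  inv := wMk d [(r, false)]
  val_inv := by
    rw [wMk_mul, ← wMk_one, wMk_eq]; exact WordEquiv.of (WordRel.cancel₁ r)
  inv_val := by
    rw [wMk_mul, ← wMk_one, wMk_eq]; exact WordEquiv.of (WordRel.cancel₂ r)

theorem evW_wU {s : ℕ} (d : Fin s → ℕ∞) (w : List (Fin s × Bool)) :
    ((evW (wU d) w : ((wCon s d).Quotient)ˣ) : (wCon s d).Quotient) = wMk d w := by
  induction w with
  | nil => simp [evW, wMk_one]
  | cons p w ih =>
    obtain ⟨r, b⟩ := p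
    rw [show (r, b) :: w = [(r, b)] ++ w from rfl, ← wMk_mul, ← ih]
    rw [evW, List.map_append, List.prod_append, Units.val_mul]
    congr 1
    cases b
    · simp [wU]
    · simp [wU]

theorem wU_pow {s : ℕ} (d : Fin s → ℕ∞) (r : Fin s) (m : ℕ) (h : d r = (m : ℕ∞)) :
    wU d r ^ m = 1 := by
  ext
  have : ∀ k : ℕ, (wMk d [(r, true)]) ^ k = wMk d (List.replicate k (r, true)) := by
    intro k
    induction k with
    | zero => rfl
    | succ k ih => rw [pow_succ, ih, wMk_mul, List.replicate_succ']
  rw [Units.val_pow_eq_pow_val, Units.val_one]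
  show (wMk d [(r, true)]) ^ m = 1
  rw [this, ← wMk_one, wMk_eq]
  exact WordEquiv.of (WordRel.power₁ r m h)

theorem evL_append {s : ℕ} {H : Type} [Group H] (v : Fin s → H) (l l' : List (Fin s × ℤ)) :
    evL v (l ++ l') = evL v l * evL v l' := by
  simp [evL]

theorem evL_cons {s : ℕ} {H : Type} [Group H] (v : Fin s → H) (p : Fin s × ℤ) (l : List (Fin s × ℤ)) :
    evL v (p :: l) = v p.1 ^ p.2 * evL v l := by
  simp [evL]

theorem WRel_init {s : ℕ} (d : Fin s → ℕ∞) (w : List (Fin s × Bool)) :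
    WRel d w (w.map fun p => (p.1, if p.2 then 1 else -1)) := by
  intro H _ v _
  have : evW v w = evL v (w.map fun p => (p.1, if p.2 then 1 else -1)) := by
    rw [evW, evL, List.map_map]
    congr 1
    apply List.map_congr_left
    intro p _
    simp only [Function.comp]
    split_ifs <;> simp
  rw [this]

theorem WRel_rotate {s : ℕ} (d : Fin s → ℕ∞) (w : List (Fin s × Bool)) (l : List (Fin s × ℤ))
    (h : WRel d w l) (i : ℕ) : WRel d w (l.rotate i) := by
  have key : ∀ a b : List (Fin s × ℤ), WRel d w (a ++ b) → WRel d w (b ++ a) := by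
    intro a b h H _ v hv
    refine (h H v hv).trans ?_
    rw [evL_append, evL_append, isConj_iff]
    exact ⟨(evL v a)⁻¹, by group⟩
  induction i with
  | zero => simpa using h
  | succ i ih =>
    rw [← List.rotate_rotate]
    cases hl : l.rotate i with
    | nil => rw [hl] at ih; simpa using ih
    | cons p t =>
      rw [hl] at ih
      rw [List.rotate_cons_succ, List.rotate_zero]
      exact key [p] t ih

theorem exists_reduced {s : ℕ} (d : Fin s → ℕ∞) (w : List (Fin s × Bool))
    (hw : ¬ WordEquiv s d w []) :
    ∃ l : List (Fin s × ℤ), WRel d w l ∧ l ≠ [] ∧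
      (∀ p ∈ l, (∀ m : ℕ, d p.1 = (m : ℕ∞) → ¬ (m : ℤ) ∣ p.2) ∧ (d p.1 = ⊤ → p.2 ≠ 0)) ∧
      (2 ≤ l.length → ∀ (i j : Fin l.length), (j : ℕ) = ((i : ℕ) + 1) % l.length →
        (l.get j).1 ≠ (l.get i).1) := by
  classical
  have hex : ∃ n : ℕ, ∃ l : List (Fin s × ℤ), WRel d w l ∧ l.length = n := ⟨_, _, WRel_init d w, rfl⟩
  obtain ⟨l, hl, hlen⟩ := Nat.find_spec hex
  have hmin : ∀ l', WRel d w l' → l.length ≤ l'.length := by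
    intro l' h'
    rw [hlen]
    exact Nat.find_min' hex ⟨l', h', rfl⟩
  have hfirst : ∀ p t, WRel d w (p :: t) → (p :: t).length = l.length →
      (∀ m : ℕ, d p.1 = (m : ℕ∞) → ¬ (m : ℤ) ∣ p.2) ∧ (d p.1 = ⊤ → p.2 ≠ 0) := by
    intro p t h hlen
    have hno : ¬ WRel d w t := by
      intro h'
      have := hmin t h'
      simp at hlen; omega
    refine ⟨fun m hm ⟨k, hk⟩ => hno ?_, fun hm hp => hno ?_⟩
    · intro H _ v hv
      have h2 := h H v hv
      rw [evL_cons, hk, zpow_mul, zpow_natCast, hv _ m hm, one_zpow, one_mul] at h2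
      exact h2
    · intro H _ v hv
      have h2 := h H v hv
      rw [evL_cons, hp, zpow_zero, one_mul] at h2
      exact h2
  have hsecond : ∀ p q t, WRel d w (p :: q :: t) → (p :: q :: t).length = l.length → q.1 ≠ p.1 := by
    intro p q t h hlen heq
    have h' : WRel d w ((p.1, p.2 + q.2) :: t) := by
      intro H _ v hv
      have h2 := h H v hv
      rw [evL_cons, evL_cons, heq, ← mul_assoc, ← zpow_add] at h2
      rw [evL_cons]
      exact h2
    have := hmin _ h'
    simp at this hlen; omega
  have hlne : l ≠ [] := by
    rintro rfl
    have h2 := hl _ (wU d) (fun r m h => wU_pow d r m h)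
    have h3 : evL (wU d) [] = 1 := rfl
    rw [h3, isConj_one_left] at h2
    apply hw
    rw [← wMk_eq d, ← evW_wU, h2]
    rfl
  refine ⟨l, hl, hlne, ?_, ?_⟩
  · intro p hp
    obtain ⟨i, hi, rfl⟩ := List.getElem_of_mem hp
    have hr := WRel_rotate d w l hl i
    have hlr : (l.rotate i).length = l.length := List.length_rotate ..
    cases hrot : l.rotate i with
    | nil => rw [hrot] at hlr; simp at hlr; omega
    | cons p t =>
      rw [hrot] at hr hlr
      have h0 : (l.rotate i)[0]'(by rw [hrot]; simp) = l[i] := by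
        rw [List.getElem_rotate]; simp [Nat.mod_eq_of_lt hi]
      simp only [hrot, List.getElem_cons_zero] at h0
      rw [← h0]
      exact hfirst p t hr hlr
  · intro h2 i j hij
    have hr := WRel_rotate d w l hl i
    have hlr : (l.rotate i).length = l.length := List.length_rotate ..
    match hrot : l.rotate i with
    | [] => rw [hrot] at hlr; simp at hlr; omega
    | [p] => rw [hrot] at hlr; simp at hlr; omega
    | p :: q :: t =>
      rw [hrot] at hr hlr
      have h0 : (l.rotate i)[0]'(by rw [hrot]; simp) = l.get i := by
        rw [List.getElem_rotate]; simp [Nat.mod_eq_of_lt i.2]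
      have h1 : (l.rotate i)[1]'(by rw [hrot]; simp) = l.get j := by
        rw [List.getElem_rotate]; simp [hij, add_comm]
      simp only [hrot, List.getElem_cons_zero, List.getElem_cons_succ] at h0 h1
      rw [← h0, ← h1]
      exact hsecond p q t hr hlr

open Classical in
/-- number of fixed points -/
def fixN {N : ℕ} (σ : Equiv.Perm (Fin N)) : ℕ := (Finset.univ.filter fun i => σ i = i).card

theorem permMat_mul (N : ℕ) (σ τ : Equiv.Perm (Fin N)) :
    permMat N (σ * τ) = permMat N σ * permMat N τ := by
  ext i j
  simp only [permMat, Matrix.mul_apply, Matrix.of_apply, Equiv.Perm.mul_apply]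
  rw [Finset.sum_eq_single (τ j)]
  · rw [if_pos rfl, mul_one]
    congr
  · intro b _ hb
    simp [hb.symm]
  · simp

theorem permMat_one (N : ℕ) : permMat N 1 = 1 := by
  ext i j
  simp [permMat, Matrix.one_apply, eq_comm]

theorem Uword_eq {s : ℕ} (N : ℕ) (σ : Fin s → Equiv.Perm (Fin N)) (w : List (Fin s × Bool)) :
    Uword N σ w = permMat N (evW σ w) := by
  induction w with
  | nil => simp [Uword, evW, permMat_one]
  | cons p w ih =>
    have h1 : Uword N σ (p :: w) =
      (if p.2 then permMat N (σ p.1) else permMat N ((σ p.1)⁻¹)) * Uword N σ w := by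
      simp [Uword]
    have h2 : evW σ (p :: w) = (if p.2 then σ p.1 else (σ p.1)⁻¹) * evW σ w := by
      simp [evW]
    rw [h1, h2, permMat_mul, ih]
    split_ifs <;> rfl

theorem trace_permMat (N : ℕ) (σ : Equiv.Perm (Fin N)) : Matrix.trace (permMat N σ) = (fixN σ : ℂ) := by
  classical
  simp only [Matrix.trace, Matrix.diag, permMat, Matrix.of_apply, fixN, Finset.card_filter]
  push_cast
  apply Finset.sum_congr rfl
  intro i _
  congr

theorem fixN_conj {N : ℕ} (σ τ : Equiv.Perm (Fin N)) (h : IsConj σ τ) : fixN σ = fixN τ := by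
  classical
  obtain ⟨c, rfl⟩ := isConj_iff.1 h
  unfold fixN
  apply Finset.card_bij (fun i _ => c i)
  · intro i hi
    have : σ i = i := (Finset.mem_filter.1 hi).2
    refine Finset.mem_filter.2 ⟨Finset.mem_univ _, ?_⟩
    simp [this]
  · intro i _ j _ h
    exact c.injective h
  · intro j hj
    refine ⟨c⁻¹ j, ?_, by simp⟩
    have : c (σ (c⁻¹ j)) = j := (Finset.mem_filter.1 hj).2
    rw [Finset.mem_filter]
    refine ⟨Finset.mem_univ _, ?_⟩
    apply c.injective
    rw [this]; simp

open Classical in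
/-- the finset of permutations -/
def Om (A : Set ℕ) (N : ℕ) : Finset (Equiv.Perm (Fin N)) := Finset.univ.filter fun σ => σ ∈ permSet A N

theorem mem_Om {A : Set ℕ} {N : ℕ} {σ : Equiv.Perm (Fin N)} : σ ∈ Om A N ↔ σ ∈ permSet A N := by
  simp [Om]

theorem Om_card (A : Set ℕ) (N : ℕ) : Nat.card ↥(permSet A N) = (Om A N).card := by
  classical
  rw [Nat.card_eq_fintype_card, Om, ← Fintype.card_subtype]

theorem Om_conj (A : Set ℕ) (N : ℕ) (π σ : Equiv.Perm (Fin N)) (h : σ ∈ Om A N) :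
    π * σ * π⁻¹ ∈ Om A N := by
  rw [mem_Om] at h ⊢
  intro i
  have h1 := h (π⁻¹ i)
  have h2 : Function.minimalPeriod (⇑(π * σ * π⁻¹)) i = Function.minimalPeriod (⇑σ) (π⁻¹ i) := by
    apply Nat.dvd_antisymm
    · rw [← Function.isPeriodicPt_iff_minimalPeriod_dvd, Function.IsPeriodicPt, Function.IsFixedPt,
        Equiv.Perm.iterate_eq_pow, conj_pow]
      have := Function.iterate_minimalPeriod (f := ⇑σ) (x := π⁻¹ i)
      rw [Equiv.Perm.iterate_eq_pow] at this
      simp only [Equiv.Perm.mul_apply, this]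
      simp
    · rw [← Function.isPeriodicPt_iff_minimalPeriod_dvd, Function.IsPeriodicPt, Function.IsFixedPt,
        Equiv.Perm.iterate_eq_pow]
      have := Function.iterate_minimalPeriod (f := ⇑(π * σ * π⁻¹)) (x := i)
      rw [Equiv.Perm.iterate_eq_pow, conj_pow] at this
      apply π.injective
      simpa using this
  rw [h2]; exact h1

theorem zpow_fix_iff {N : ℕ} (σ : Equiv.Perm (Fin N)) (e : ℤ) (i : Fin N) :
    (σ ^ e) i = i ↔ (Function.minimalPeriod σ i : ℤ) ∣ e :=
  MulAction.zpow_smul_eq_iff_minimalPeriod_dvd (a := σ) (b := i) (n := e)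

theorem poly_exp_bound (c k : ℕ) : ∃ B : ℝ, 0 ≤ B ∧ ∀ X : ℕ, (1 + (c:ℝ) * X) ^ k ≤ B * 2 ^ X := by
  have h := tendsto_pow_const_div_const_pow_of_one_lt k (r := (2:ℝ)) (by norm_num)
  obtain ⟨B, hB⟩ := (Metric.isBounded_range_of_tendsto _ h).exists_norm_le
  have hB' : ∀ n : ℕ, |(n:ℝ) ^ k / 2 ^ n| ≤ B := fun n => hB _ ⟨n, rfl⟩
  have hB0 : 0 ≤ B := (abs_nonneg _).trans (hB' 0)
  refine ⟨(1 + c) ^ k * (2 * B), by positivity, fun X => ?_⟩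
  have h1 := (le_abs_self _).trans (hB' (X+1))
  rw [div_le_iff₀ (by positivity)] at h1
  calc (1 + (c:ℝ) * X) ^ k ≤ ((1 + c) * ((X+1 : ℕ):ℝ)) ^ k := by
        apply pow_le_pow_left₀ (by positivity)
        push_cast
        nlinarith [(Nat.cast_nonneg c : (0:ℝ) ≤ c), (Nat.cast_nonneg X : (0:ℝ) ≤ X)]
    _ = (1 + c) ^ k * ((X+1 : ℕ):ℝ) ^ k := by rw [mul_pow]
    _ ≤ (1 + c) ^ k * (B * 2 ^ (X+1)) := by
        apply mul_le_mul_of_nonneg_left h1 (by positivity)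
    _ = _ := by ring

section moments
variable {s : ℕ} {T : Type} [Fintype T]

theorem moment_single (m : ℕ) (p : T → Prop) (e : T → ℤ) (k : ℕ)
    (hp : ∀ t, p t → ¬ (m:ℤ) ∣ e t) (N : ℕ) :
    ∑ σ ∈ Om {m} N, (1 + (fixF p e σ : ℝ)) ^ k ≤ 1 * (Om {m} N).card := by
  classical
  rw [one_mul, Finset.card_eq_sum_ones]
  push_cast
  apply Finset.sum_le_sum
  intro σ hσ
  rw [mem_Om] at hσ
  have : fixF p e σ = 0 := by
    unfold fixF
    apply Finset.sum_eq_zero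
    intro t ht
    rw [Finset.card_eq_zero, Finset.filter_eq_empty_iff]
    intro i _ hi
    rw [zpow_fix_iff] at hi
    have h2 : Function.minimalPeriod σ i = m := hσ i
    rw [h2] at hi
    exact hp t (by simpa using ht) hi
  rw [this]; simp

theorem moment_infinite (A : Set ℕ)
    (hs : Summable ((Aᶜ : Set ℕ).indicator fun j => (1 : ℝ) / j)) (p : T → Prop) (e : T → ℤ) (k : ℕ)
    (hp : ∀ t, p t → e t ≠ 0) :
    ∃ C : ℝ, 0 ≤ C ∧ ∃ N0 : ℕ, ∀ N ≥ N0,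
      ∑ σ ∈ Om A N, (1 + (fixF p e σ : ℝ)) ^ k ≤ C * (Om A N).card := by
  classical
  set E : ℕ := ∏ t, (if p t then (e t).natAbs else 1) with hE
  have hE0 : 0 < E := by
    apply Finset.prod_pos
    intro t _
    split_ifs with h
    · exact Int.natAbs_pos.2 (hp t h)
    · exact one_pos
  obtain ⟨C, hC, N0, h1⟩ := moment_inf A hs E hE0
  obtain ⟨B, hB, h2⟩ := poly_exp_bound (Fintype.card T) k
  refine ⟨B * C, by positivity, N0, fun N hN => ?_⟩
  have h3 : ∀ σ : Equiv.Perm (Fin N), fixF p e σ ≤ Fintype.card T * fixN (σ ^ E) := by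
    intro σ
    unfold fixF
    calc _ ≤ ∑ t ∈ Finset.univ.filter p, fixN (σ ^ E) := by
          apply Finset.sum_le_sum
          intro t ht
          unfold fixN
          apply Finset.card_le_card
          intro i hi
          have hi' : (σ ^ (e t)) i = i := by simpa using hi
          rw [zpow_fix_iff] at hi'
          rw [Finset.mem_filter]
          refine ⟨Finset.mem_univ _, ?_⟩
          rw [← zpow_natCast, zpow_fix_iff]
          have ht' : p t := by simpa using ht
          have hd : (e t).natAbs ∣ E := by
            have := Finset.dvd_prod_of_mem (fun t => if p t then (e t).natAbs else 1) (Finset.mem_univ t)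
            simpa [ht'] using this
          exact hi'.trans ((Int.dvd_natAbs.2 dvd_rfl).trans (by exact_mod_cast hd))
      _ ≤ ∑ t : T, fixN (σ ^ E) := Finset.sum_le_sum_of_subset (Finset.filter_subset _ _)
      _ = _ := by rw [Finset.sum_const, Finset.card_univ, smul_eq_mul]
  calc _ ≤ ∑ σ ∈ Om A N, B * 2 ^ (fixN (σ ^ E)) := by
        apply Finset.sum_le_sum
        intro σ _
        refine le_trans ?_ (h2 _)
        apply pow_le_pow_left₀ (by positivity)
        have : (fixF p e σ : ℝ) ≤ Fintype.card T * fixN (σ ^ E) := by exact_mod_cast h3 σ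
        linarith
    _ = B * ∑ σ ∈ Om A N, 2 ^ (fixN (σ ^ E)) := by rw [Finset.mul_sum]
    _ ≤ B * (C * (Om A N).card) := by
        apply mul_le_mul_of_nonneg_left _ hB
        have := h1 N hN
        simpa only [Om, fixN] using this
    _ = _ := by ring

theorem moment_all (d : Fin s → ℕ∞) (A : Fin s → Set ℕ)
    (hd1 : ∀ r m, A r = {m} → d r = (m : ℕ∞)) (hd2 : ∀ r, (A r).Infinite → d r = ⊤)
    (hAcond : ∀ r, (A r).Finite ∨
      Summable (((A r)ᶜ : Set ℕ).indicator fun j => (1 : ℝ) / j))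
    (hAsi : ∀ r, (∃ m : ℕ, A r = {m}) ∨ (A r).Infinite)
    (r : T → Fin s) (e : T → ℤ) (k : ℕ)
    (hp : ∀ t, (∀ m : ℕ, d (r t) = (m : ℕ∞) → ¬ (m : ℤ) ∣ e t) ∧ (d (r t) = ⊤ → e t ≠ 0)) :
    ∃ C : ℝ, 0 ≤ C ∧ ∃ N0 : ℕ, ∀ N ≥ N0, ∀ i,
      ∑ σ ∈ Om (A i) N, (1 + (fixF (fun t => r t = i) e σ : ℝ)) ^ k ≤ C * (Om (A i) N).card := by
  have h : ∀ i, ∃ C : ℝ, 0 ≤ C ∧ ∃ N0 : ℕ, ∀ N ≥ N0,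
      ∑ σ ∈ Om (A i) N, (1 + (fixF (fun t => r t = i) e σ : ℝ)) ^ k ≤ C * (Om (A i) N).card := by
    intro i
    rcases hAsi i with ⟨m, hm⟩ | hinf
    · refine ⟨1, zero_le_one, 0, fun N _ => ?_⟩
      rw [hm]
      apply moment_single
      rintro t rfl
      exact (hp t).1 m (hd1 _ m hm)
    · apply moment_infinite (A i) ((hAcond i).resolve_left hinf)
      rintro t rfl
      exact (hp t).2 (hd2 _ hinf)
  choose C hC N0 hN using h
  refine ⟨∑ i, C i, Finset.sum_nonneg fun i _ => hC i, ∑ i, N0 i, fun N hN' i => ?_⟩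
  refine (hN i N ?_).trans ?_
  · exact le_trans (Finset.single_le_sum (f := N0) (fun _ _ => Nat.zero_le _) (Finset.mem_univ i)) hN'
  · apply mul_le_mul_of_nonneg_right _ (Nat.cast_nonneg _)
    exact Finset.single_le_sum (f := C) (fun j _ => hC j) (Finset.mem_univ i)

end moments

theorem one_syllable {s N : ℕ} (Ω : Fin s → Finset (Equiv.Perm (Fin N))) (i : Fin s)
    (F : Equiv.Perm (Fin N) → ℝ) (hF : ∀ σ, 0 ≤ F σ) (C : ℝ)
    (h : ∑ σ ∈ Ω i, F σ ≤ C * (Ω i).card) :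
    ∑ σ ∈ Fintype.piFinset Ω, F (σ i) ≤ C * ∏ j, ((Ω j).card : ℝ) := by
  classical
  have h1 := Finset.prod_univ_sum Ω (fun j σ => if j = i then F σ else 1)
  have h2 : ∑ σ ∈ Fintype.piFinset Ω, F (σ i) =
      ∑ σ ∈ Fintype.piFinset Ω, ∏ j, (if j = i then F (σ j) else 1) := by
    apply Finset.sum_congr rfl
    intro σ _
    rw [Finset.prod_ite_eq' ]
    simp
  rw [h2, ← h1]
  calc _ ≤ ∏ j, ((if j = i then C else 1) * ((Ω j).card : ℝ)) := by
        apply Finset.prod_le_prod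
        · intro j _
          apply Finset.sum_nonneg
          intro σ _
          split_ifs
          · exact hF _
          · exact zero_le_one
        · intro j _
          by_cases hj : j = i
          · subst hj; simpa using h
          · simp [hj]
    _ = _ := by
        rw [Finset.prod_mul_distrib, Finset.prod_ite_eq']
        simp

open Classical in
theorem traj_count {s N : ℕ} (σ : Fin s → Equiv.Perm (Fin N)) (l : List (Fin s × ℤ)) (hl : 0 < l.length)
    (nxt : Fin l.length → Fin l.length) (hnxt : ∀ t, (nxt t : ℕ) = ((t : ℕ) + 1) % l.length) :
    (fixN (evL σ l)) ^ 2 ≤ (Finset.univ.filter fun x : Fin l.length × Bool → Fin N =>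
      ∀ t, ((σ (l.get t.1).1) ^ ((l.get t.1).2)) (x (nxt t.1, t.2)) = x t).card := by
  rw [fixN, sq, ← Finset.card_product]
  apply Finset.card_le_card_of_injOn
    (fun (z : Fin N × Fin N) (t : Fin l.length × Bool) => evL σ (l.drop t.1) (if t.2 then z.1 else z.2))
  · rintro ⟨i, j⟩ hz
    have hz' : evL σ l i = i ∧ evL σ l j = j := by simpa using hz
    rw [Finset.mem_coe, Finset.mem_filter]
    refine ⟨Finset.mem_univ _, ?_⟩
    rintro ⟨t, b⟩
    have hy : evL σ l (if b then i else j) = (if b then i else j) := by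
      split_ifs
      · exact hz'.1
      · exact hz'.2
    simp only
    generalize (if b then i else j) = y at hy ⊢
    have hd : l.drop t = l.get t :: l.drop (t + 1) := by
      rw [List.drop_eq_getElem_cons t.2]; rfl
    rw [hd, evL_cons, Equiv.Perm.mul_apply]
    congr 1
    rw [hnxt]
    by_cases ht : (t:ℕ) + 1 < l.length
    · rw [Nat.mod_eq_of_lt ht]
    · have : (t:ℕ) + 1 = l.length := by have := t.2; omega
      rw [this, Nat.mod_self, List.drop_zero, hy, List.drop_length]
      rfl
  · rintro ⟨i, j⟩ hz ⟨i', j'⟩ hz' h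
    have h1 : evL σ l i = i ∧ evL σ l j = j := by simpa using hz
    have h2 : evL σ l i' = i' ∧ evL σ l j' = j' := by simpa using hz'
    have ha := congrFun h (⟨0, hl⟩, true)
    have hb := congrFun h (⟨0, hl⟩, false)
    simp [h1.1, h2.1, h1.2, h2.2] at ha hb
    rw [ha, hb]

theorem second_moment {s : ℕ} (hs : 0 < s) (d : Fin s → ℕ∞) (A : Fin s → Set ℕ)
    (hd1 : ∀ r m, A r = {m} → d r = (m : ℕ∞)) (hd2 : ∀ r, (A r).Infinite → d r = ⊤)
    (hAcond : ∀ r, (A r).Finite ∨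
      Summable (((A r)ᶜ : Set ℕ).indicator fun j => (1 : ℝ) / j))
    (hAsi : ∀ r, (∃ m : ℕ, A r = {m}) ∨ (A r).Infinite)
    (w : List (Fin s × Bool)) (hw : ¬ WordEquiv s d w []) :
    ∃ K : ℝ, 0 ≤ K ∧ ∃ N0 : ℕ, ∀ N ≥ N0,
      ∑ σ ∈ Fintype.piFinset (fun r => Om (A r) N), (fixN (evW σ w) : ℝ) ^ 2 ≤
        K * ∏ r, ((Om (A r) N).card : ℝ) := by
  classical
  obtain ⟨l, hl, hne, hnt, hadj⟩ := exists_reduced d w hw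
  have hfix : ∀ N, ∀ σ ∈ Fintype.piFinset (fun r => Om (A r) N), fixN (evW σ w) = fixN (evL σ l) := by
    intro N σ hσ
    apply fixN_conj
    apply hl
    intro r m hm
    rcases hAsi r with ⟨m', hm'⟩ | hinf
    · have h1 := hd1 r m' hm'
      rw [hm] at h1
      have h2 : m = m' := by exact_mod_cast h1
      subst h2
      have h3 : σ r ∈ permSet (A r) N := mem_Om.1 (Fintype.mem_piFinset.1 hσ r)
      rw [hm'] at h3
      ext i
      have h4 : Function.minimalPeriod (σ r) i = m := h3 i
      have := Function.iterate_minimalPeriod (f := ⇑(σ r)) (x := i)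
      rw [h4, Equiv.Perm.iterate_eq_pow] at this
      rw [this]; rfl
    · rw [hd2 r hinf] at hm
      exact absurd hm (ENat.top_ne_natCast m)
  have hlen : 0 < l.length := List.length_pos_iff.2 hne
  rcases Nat.lt_or_ge l.length 2 with h1 | h2
  · have hl1 : l.length = 1 := by omega
    obtain ⟨⟨r, e⟩, rfl⟩ := List.length_eq_one_iff.1 hl1
    obtain ⟨C, hC, N0, hM⟩ := moment_all (T := Unit) d A hd1 hd2 hAcond hAsi (fun _ => r) (fun _ => e) 2
      (fun _ => hnt (r, e) (by simp))
    refine ⟨C, hC, N0, fun N hN => ?_⟩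
    have h3 : ∑ σ ∈ Om (A r) N, (fixN (σ ^ e) : ℝ) ^ 2 ≤ C * (Om (A r) N).card := by
      refine le_trans ?_ (hM N hN r)
      apply Finset.sum_le_sum
      intro σ _
      apply pow_le_pow_left₀ (by positivity)
      have : fixF (fun _ : Unit => r = r) (fun _ => e) σ = fixN (σ ^ e) := by
        simp [fixF, fixN]
      rw [this]; linarith
    have h4 := one_syllable (fun r => Om (A r) N) r (fun σ => (fixN (σ ^ e) : ℝ) ^ 2) (fun _ => by positivity) C h3
    refine le_trans (le_of_eq ?_) h4
    apply Finset.sum_congr rfl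
    intro σ hσ
    rw [hfix N σ hσ]
    simp [evL]
  · set n := l.length with hn
    let nx : Fin n → Fin n := fun t => ⟨((t:ℕ) + 1) % n, Nat.mod_lt _ hlen⟩
    have hnx : Function.Surjective nx := by
      intro t
      refine ⟨⟨((t:ℕ) + (n - 1)) % n, Nat.mod_lt _ hlen⟩, ?_⟩
      apply Fin.ext
      simp only [nx]
      rw [Nat.mod_add_mod, show (t:ℕ) + (n-1) + 1 = t + n by omega, Nat.add_mod_right, Nat.mod_eq_of_lt t.2]
    let T := Fin n × Bool
    let nxt : T → T := fun t => (nx t.1, t.2)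
    have hnxt : Function.Surjective nxt := by
      rintro ⟨t, b⟩
      obtain ⟨t', rfl⟩ := hnx t
      exact ⟨(t', b), rfl⟩
    let r : T → Fin s := fun t => (l.get t.1).1
    let e : T → ℤ := fun t => (l.get t.1).2
    have hadj' : ∀ t, r (nxt t) ≠ r t := fun t => hadj h2 t.1 (nx t.1) rfl
    obtain ⟨C, hC, N0, hM⟩ := moment_all (T := T) d A hd1 hd2 hAcond hAsi r e (Fintype.card T)
      (fun t => hnt _ (List.get_mem _ _))
    obtain ⟨K, hK, hmain⟩ := pattern_main nxt hnxt r e hadj' C hC hs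
    refine ⟨K, hK, N0 + 2 * Fintype.card T + 1, fun N hN => ?_⟩
    have h3 := hmain N (by omega) (by omega) (fun r => Om (A r) N) (fun i => Om_conj (A i) N)
      (hM N (by omega))
    refine le_trans ?_ h3
    apply Finset.sum_le_sum
    intro σ hσ
    rw [hfix N σ hσ]
    have h5 : (fixN (evL σ l)) ^ 2 ≤ (Finset.univ.filter fun x : T → Fin N =>
        ∀ t, ((σ (r t)) ^ (e t)) (x (nxt t)) = x t).card := by
      convert traj_count σ l hlen nx (fun _ => rfl)
    have h6 : ((fixN (evL σ l) : ℝ)) ^ 2 ≤ ((Finset.univ.filter fun x : T → Fin N =>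
        ∀ t, ((σ (r t)) ^ (e t)) (x (nxt t)) = x t).card : ℝ) := by exact_mod_cast h5
    refine h6.trans (le_of_eq ?_)
    congr!

theorem EE_norm_le {s : ℕ} (A : Fin s → Set ℕ) (N : ℕ) (h : (Fin s → Equiv.Perm (Fin N)) → ℂ) (K : ℝ) (hK : 0 ≤ K)
    (hh : ∑ σ ∈ Fintype.piFinset (fun r => Om (A r) N), ‖h σ‖ ≤ K * ∏ r, ((Om (A r) N).card : ℝ)) :
    ‖EE A N h‖ ≤ K := by
  classical
  rw [EE, norm_div]
  have h1 : ‖∏ r : Fin s, (Nat.card ↥(permSet (A r) N) : ℂ)‖ = ∏ r, ((Om (A r) N).card : ℝ) := by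
    rw [norm_prod]
    apply Finset.prod_congr rfl
    intro r _
    rw [Om_card, Complex.norm_natCast]
  rw [h1]
  apply div_le_of_le_mul₀ (Finset.prod_nonneg fun _ _ => Nat.cast_nonneg _) hK
  refine le_trans ?_ hh
  rw [finsum_eq_sum_of_fintype]
  rw [← Finset.sum_subtype (Fintype.piFinset (fun r => Om (A r) N)) (p := fun σ => ∀ r, σ r ∈ permSet (A r) N)
    (fun σ => by simp [Fintype.mem_piFinset, mem_Om]) h]
  exact norm_sum_le _ _

/-- If each `A_r` is a singleton or infinite, `(N_k)` is an increasing sequence with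
`S_{N_k}^{(A_r)} ≠ ∅`, and `w₁ ≉ e ≉ w₂`, then there exists `δ > 0` with
`E_k[tr U_{w₁} · tr U_{w₂}] = O(1/N_k^{1+δ})` as `k → ∞`. -/
theorem expectation_trace_pair_bigO
    (s : ℕ) (hs : 0 < s) (d : Fin s → ℕ∞) (hd : ∀ r, 1 ≤ d r)
    (A : Fin s → Set ℕ)
    (hAne : ∀ r, (A r).Nonempty) (hApos : ∀ r, ∀ m ∈ A r, 0 < m)
    (hAsup : ∀ r, (∀ m ∈ A r, (m : ℕ∞) ≤ d r) ∧
      ∀ e : ℕ∞, (∀ m ∈ A r, (m : ℕ∞) ≤ e) → d r ≤ e)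
    (hAcond : ∀ r, (A r).Finite ∨
      Summable (((A r)ᶜ : Set ℕ).indicator fun j => (1 : ℝ) / j))
    (hAsi : ∀ r, (∃ m : ℕ, A r = {m}) ∨ (A r).Infinite)
    (Nk : ℕ → ℕ) (hmono : StrictMono Nk) (hNpos : ∀ k, 0 < Nk k)
    (hSne : ∀ k r, (permSet (A r) (Nk k)).Nonempty)
    (w₁ w₂ : List (Fin s × Bool))
    (hw₁ : ¬ WordEquiv s d w₁ []) (hw₂ : ¬ WordEquiv s d w₂ []) :
    ∃ δ : ℝ, 0 < δ ∧
      (fun k => EE A (Nk k) fun σ =>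
          ntr (Uword (Nk k) σ w₁) * ntr (Uword (Nk k) σ w₂))
        =O[atTop] fun k => (1 : ℝ) / (Nk k : ℝ) ^ ((1 : ℝ) + δ) := by
  have hd1 : ∀ r m, A r = {m} → d r = (m : ℕ∞) := by
    intro r m hm
    apply le_antisymm
    · apply (hAsup r).2
      intro m' hm'
      rw [hm] at hm'
      rw [Set.mem_singleton_iff.1 hm']
    · apply (hAsup r).1
      rw [hm]; exact rfl
  have hd2 : ∀ r, (A r).Infinite → d r = ⊤ := by
    intro r hinf
    by_contra hne
    obtain ⟨m, hm⟩ := ENat.ne_top_iff_exists.1 hne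
    apply hinf
    apply (Set.finite_Iic m).subset
    intro j hj
    have := (hAsup r).1 j hj
    rw [← hm] at this
    exact_mod_cast this
  obtain ⟨K1, hK1, N1, h1⟩ := second_moment hs d A hd1 hd2 hAcond hAsi w₁ hw₁
  obtain ⟨K2, hK2, N2, h2⟩ := second_moment hs d A hd1 hd2 hAcond hAsi w₂ hw₂
  refine ⟨1, one_pos, ?_⟩
  apply Asymptotics.IsBigO.of_bound ((K1 + K2) / 2)
  filter_upwards [hmono.tendsto_atTop.eventually_ge_atTop (N1 + N2)] with k hk
  have hN : (0:ℝ) < Nk k := by exact_mod_cast hNpos k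
  have hp : ‖(1:ℝ) / (Nk k : ℝ) ^ ((1:ℝ) + 1)‖ = 1 / (Nk k : ℝ) ^ 2 := by
    rw [show (1:ℝ) + 1 = ((2:ℕ):ℝ) by norm_num, Real.rpow_natCast, Real.norm_of_nonneg (by positivity)]
  rw [hp]
  generalize Nk k = N at *
  apply EE_norm_le
  · positivity
  have hb : ∀ σ : Fin s → Equiv.Perm (Fin N), ‖ntr (Uword N σ w₁) * ntr (Uword N σ w₂)‖ ≤
      ((fixN (evW σ w₁) : ℝ) ^ 2 + (fixN (evW σ w₂) : ℝ) ^ 2) * (1 / (2 * (N:ℝ) ^ 2)) := by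
    intro σ
    rw [ntr, ntr, Uword_eq, Uword_eq, trace_permMat, trace_permMat, norm_mul, norm_div, norm_div]
    simp only [Complex.norm_natCast]
    rw [div_mul_div_comm, mul_one_div, div_le_div_iff₀ (by positivity) (by positivity)]
    nlinarith [mul_nonneg (sq_nonneg ((fixN (evW σ w₁) : ℝ) - (fixN (evW σ w₂) : ℝ))) (sq_nonneg (N:ℝ))]
  refine (Finset.sum_le_sum fun σ _ => hb σ).trans ?_
  rw [← Finset.sum_mul, Finset.sum_add_distrib]
  calc _ ≤ (K1 * ∏ r, ((Om (A r) N).card : ℝ) + K2 * ∏ r, ((Om (A r) N).card : ℝ)) * (1 / (2 * (N:ℝ) ^ 2)) := by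
        apply mul_le_mul_of_nonneg_right _ (by positivity)
        exact add_le_add (h1 N (by omega)) (h2 N (by omega))
    _ = _ := by
        field_simp
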